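/- arXiv:2104.14858 — 2 statements merged into one kernel-verified Lean document; each statement's English description precedes it below -/
import Mathlib

section
/- (Core affine iterated-random-function theorem underlying Theorems 1 and 4 and Propositions 1–2.) Let 𝒜 be a d×d real Schur matrix, let β₁, …, β_L ∈ ℝ^d, and define affine maps W_ℓ(ξ) = 𝒜ξ + β_ℓ for ℓ = 1, …, L. Let p₁, …, p_L : ℝ^d → [0,1] be Dini continuous probability functions with Σ_ℓ p_ℓ(x) = 1 for all x, and suppose there exists δ > 0 such that p_ℓ(x) ≥ δ for all ℓ and all x. Then the Markov kernel κ(x) = Σ_ℓ p_ℓ(x)·δ_{W_ℓ(x)} admits a unique invariant Borel probability measure μ*, and μ* is attractive: for every Borel probability measure ν on ℝ^d, the iterates ν₀ = ν, ν_{k+1} = ν_k.bind κ converge weakly to μ*. -/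
open MeasureTheory Filter Topology

noncomputable section

/-- A real square matrix is Schur if every complex eigenvalue has modulus `< 1`. -/
def IsSchur {ι : Type*} [Fintype ι] [DecidableEq ι] (A : Matrix ι ι ℝ) : Prop :=
  ∀ z ∈ spectrum ℂ (A.map (fun x : ℝ => (x : ℂ))), ‖z‖ < 1

/-- `p` is Dini continuous: `|p x - p y| ≤ φ (dist x y)` for a nondecreasing modulus `φ` with
`φ 0 = 0` and `∫₀¹ φ t / t dt < ∞`. -/
def DiniContinuous {X : Type*} [PseudoMetricSpace X] (p : X → ℝ) : Prop :=
  ∃ φ : ℝ → ℝ, MonotoneOn φ (Set.Ici 0) ∧ φ 0 = 0 ∧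
    IntervalIntegrable (fun t => φ t / t) volume 0 1 ∧
    ∀ x y, |p x - p y| ≤ φ (dist x y)

/-- The Markov kernel `κ x = ∑ ℓ, p ℓ x • δ_{W ℓ x}` of an iterated random function given by
maps `W ℓ` chosen with place-dependent probabilities `p ℓ`. -/
def IFSKernel {X : Type*} [MeasurableSpace X] {L : ℕ}
    (p : Fin L → X → ℝ) (W : Fin L → X → X) (x : X) : Measure X :=
  ∑ ℓ, ENNReal.ofReal (p ℓ x) • Measure.dirac (W ℓ x)

/-- A measure `μ` is invariant for the kernel `κ` if `μ.bind κ = μ`. -/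
def Invariant {X : Type*} [MeasurableSpace X] (κ : X → Measure X) (μ : Measure X) : Prop :=
  μ.bind κ = μ

/-- A measure `μ` is attractive for the kernel `κ` if for every Borel probability measure `ν`,
the iterates `ν, ν.bind κ, (ν.bind κ).bind κ, …` converge weakly to `μ`. -/
def Attractive {X : Type*} [MeasurableSpace X] [TopologicalSpace X]
    (κ : X → Measure X) (μ : Measure X) : Prop :=
  ∀ ν : Measure X, IsProbabilityMeasure ν →
    ∀ f : BoundedContinuousFunction X ℝ,
      Tendsto (fun k => ∫ x, f x ∂((fun m : Measure X => m.bind κ)^[k] ν))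
        atTop (𝓝 (∫ x, f x ∂μ))

def ifsOp {X : Type*} {L : ℕ} (p : Fin L → X → ℝ) (W : Fin L → X → X) (g : X → ℝ) (x : X) : ℝ :=
  ∑ i, p i x * g (W i x)

lemma ifs_coupling {L : ℕ} (u v g h : Fin L → ℝ)
    (hu0 : ∀ i, 0 ≤ u i) (hv0 : ∀ i, 0 ≤ v i) (hu : ∑ i, u i = 1) (hv : ∑ i, v i = 1)
    (a b ε : ℝ) (hab : a ≤ b) (hε : 1 - ∑ i, min (u i) (v i) ≤ ε)
    (hga : ∀ i, g i - h i ≤ a) (hgb : ∀ i j, g i - h j ≤ b) :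
    ∑ i, u i * g i - ∑ i, v i * h i ≤ (1 - ε) * a + ε * b := by
  have hne : (Finset.univ : Finset (Fin L)).Nonempty := by
    by_contra hne
    rw [Finset.not_nonempty_iff_eq_empty] at hne
    rw [hne] at hu
    simp at hu
  obtain ⟨j0, -, hj0⟩ := Finset.exists_min_image Finset.univ h hne
  have h1 : ∑ i, u i * g i - ∑ i, v i * h i
      ≤ ∑ i, (min (u i) (v i) * a + (u i - min (u i) (v i)) * (h j0 + b)
          - (v i - min (u i) (v i)) * h j0) := by
    rw [← Finset.sum_sub_distrib]
    apply Finset.sum_le_sum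
    intro i _
    have e1 : 0 ≤ min (u i) (v i) := le_min (hu0 i) (hv0 i)
    have e2 : 0 ≤ u i - min (u i) (v i) := sub_nonneg.2 (min_le_left _ _)
    have e3 : 0 ≤ v i - min (u i) (v i) := sub_nonneg.2 (min_le_right _ _)
    have f1 := mul_le_mul_of_nonneg_left (hga i) e1
    have f2 := mul_le_mul_of_nonneg_left (show g i ≤ h j0 + b by linarith [hgb i j0]) e2
    have f3 := mul_le_mul_of_nonneg_left (hj0 i (Finset.mem_univ i)) e3
    nlinarith
  have h2 : ∑ i, (min (u i) (v i) * a + (u i - min (u i) (v i)) * (h j0 + b)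
          - (v i - min (u i) (v i)) * h j0)
      = (∑ i, min (u i) (v i)) * a + (1 - ∑ i, min (u i) (v i)) * b := by
    simp only [Finset.sum_sub_distrib, Finset.sum_add_distrib, ← Finset.sum_mul, hu, hv]
    ring
  rw [h2] at h1
  nlinarith [mul_le_mul_of_nonneg_right hε (sub_nonneg.2 hab)]

section abstractIFS

variable {X : Type*} {L : ℕ} {p : Fin L → X → ℝ} {W : Fin L → X → X}
  {D : X → X → ℝ} {r R δ : ℝ} {ε : ℕ → ℝ}

structure GoodIFS (p : Fin L → X → ℝ) (W : Fin L → X → X) (D : X → X → ℝ)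
    (r R δ : ℝ) (ε : ℕ → ℝ) : Prop where
  p0 : ∀ i x, 0 ≤ p i x
  psum : ∀ x, ∑ i, p i x = 1
  symm : ∀ x y, D x y = D y x
  r0 : 0 < r
  r1 : r < 1
  R0 : 0 < R
  d0 : 0 < δ
  contr : ∀ i x y, D (W i x) (W i y) ≤ r * D x y
  absorb : ∀ i j x y, D x y ≤ R → D (W i x) (W j y) ≤ R
  eps : ∀ n x y, D x y ≤ r ^ n * R → 1 - ∑ i, min (p i x) (p i y) ≤ ε n
  eps0 : ∀ n, 0 ≤ ε n
  eps1 : ∀ n, ε n ≤ 1 - δ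
  sum : Summable ε

def OscLe (D : X → X → ℝ) (g : X → ℝ) (t b : ℝ) : Prop := ∀ x y, D x y ≤ t → |g x - g y| ≤ b

lemma GoodIFS.step (H : GoodIFS p W D r R δ ε) {g : X → ℝ} {n : ℕ} {a b : ℝ} (hab : a ≤ b)
    (ha : OscLe D g (r ^ (n + 1) * R) a) (hb : OscLe D g R b) :
    OscLe D (ifsOp p W g) (r ^ n * R) ((1 - ε n) * a + ε n * b) := by
  have key : ∀ x y, D x y ≤ r ^ n * R →
      ifsOp p W g x - ifsOp p W g y ≤ (1 - ε n) * a + ε n * b := by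
    intro x y hxy
    apply ifs_coupling (fun i => p i x) (fun i => p i y) _ _ (fun i => H.p0 i x)
      (fun i => H.p0 i y) (H.psum x) (H.psum y) a b (ε n) hab (H.eps n x y hxy)
    · intro i
      refine (le_abs_self _).trans (ha _ _ ((H.contr i x y).trans ?_))
      rw [pow_succ']
      nlinarith [H.r0]
    · intro i j
      refine (le_abs_self _).trans (hb _ _ (H.absorb i j x y (hxy.trans ?_)))
      have := pow_le_one₀ (n := n) H.r0.le H.r1.le
      nlinarith [H.R0]
  intro x y hxy
  rw [abs_le]
  constructor
  · have := key y x (by rwa [H.symm])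
    linarith
  · exact key x y hxy

lemma GoodIFS.mono (H : GoodIFS p W D r R δ ε) {g : X → ℝ} {b : ℝ} (hb : OscLe D g R b) :
    OscLe D (ifsOp p W g) R b := by
  have := H.step (n := 0) (le_refl b) (g := g) ?_ hb
  · have e : (1 - ε 0) * b + ε 0 * b = b := by ring
    rw [e] at this
    simpa using this
  · intro x y hxy
    refine hb x y (hxy.trans ?_)
    have := H.r1
    have := H.R0
    simp only [zero_add, pow_one]
    nlinarith

lemma GoodIFS.mono_iter (H : GoodIFS p W D r R δ ε) {g : X → ℝ} {b : ℝ} (hb : OscLe D g R b)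
    (n : ℕ) : OscLe D ((ifsOp p W)^[n] g) R b := by
  induction n with
  | zero => exact hb
  | succ n ih => rw [Function.iterate_succ_apply']; exact H.mono ih

lemma GoodIFS.iter (H : GoodIFS p W D r R δ ε) {g : X → ℝ} {a b : ℝ} (hab : a ≤ b)
    (hb : OscLe D g R b) (i : ℕ) : ∀ j, OscLe D g (r ^ (i + j) * R) a →
    OscLe D ((ifsOp p W)^[i] g) (r ^ j * R)
      (b - (∏ l ∈ Finset.range i, (1 - ε (j + l))) * (b - a)) := by
  induction i with
  | zero => intro j h; simpa using h
  | succ i ih =>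
    intro j h
    rw [Function.iterate_succ_apply']
    have h1 := ih (j + 1) (by rwa [show i + (j + 1) = i + 1 + j by ring])
    have hprod : 0 ≤ ∏ l ∈ Finset.range i, (1 - ε (j + 1 + l)) :=
      Finset.prod_nonneg fun l _ => by linarith [H.eps1 (j + 1 + l), H.d0]
    have h2 := H.step (by nlinarith) h1 (H.mono_iter hb i)
    convert h2 using 1
    rw [Finset.prod_range_succ']
    have e : ∏ l ∈ Finset.range i, (1 - ε (j + (l + 1)))
        = ∏ l ∈ Finset.range i, (1 - ε (j + 1 + l)) :=
      Finset.prod_congr rfl fun l _ => by rw [show j + (l + 1) = j + 1 + l by ring]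
    rw [e, add_zero]
    ring

lemma GoodIFS.prod_lb (H : GoodIFS p W D r R δ ε) (n : ℕ) :
    Real.exp (-((∑' k, ε k) / δ)) ≤ ∏ l ∈ Finset.range n, (1 - ε l) := by
  have h1 : ∀ l, Real.exp (-(ε l / δ)) ≤ 1 - ε l := by
    intro l
    have hd := H.d0
    have h2 := H.eps1 l
    have h0 := H.eps0 l
    rw [Real.exp_neg]
    apply inv_le_of_inv_le₀ (by linarith)
    refine le_trans ?_ (Real.add_one_le_exp _)
    rw [inv_le_iff_one_le_mul₀ (by linarith)]
    have : ε l ≤ ε l / δ * (1 - ε l) := by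
      rw [div_mul_eq_mul_div, le_div_iff₀ hd]
      nlinarith
    nlinarith
  calc Real.exp (-((∑' k, ε k) / δ)) ≤ Real.exp (∑ l ∈ Finset.range n, -(ε l / δ)) := by
        apply Real.exp_le_exp.2
        rw [Finset.sum_neg_distrib, ← Finset.sum_div]
        have := H.sum.sum_le_tsum (Finset.range n) (fun i _ => H.eps0 i)
        have := H.d0
        gcongr
    _ = ∏ l ∈ Finset.range n, Real.exp (-(ε l / δ)) := Real.exp_sum _ _
    _ ≤ _ := Finset.prod_le_prod (fun _ _ => (Real.exp_pos _).le) (fun l _ => h1 l)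

def ScaleUC (D : X → X → ℝ) (r R : ℝ) (g : X → ℝ) : Prop :=
  ∀ η, 0 < η → ∃ k, OscLe D g (r ^ k * R) η

lemma OscLe.anti {g : X → ℝ} {t s b : ℝ} (h : OscLe D g t b) (hst : s ≤ t) : OscLe D g s b :=
  fun x y hxy => h x y (hxy.trans hst)

lemma GoodIFS.scaleUC (H : GoodIFS p W D r R δ ε) {g : X → ℝ} {b : ℝ} (hb : OscLe D g R b)
    (hg : ScaleUC D r R g) : ScaleUC D r R (ifsOp p W g) := by
  intro η hη
  obtain ⟨k, hk⟩ := hg (η / 2) (by linarith)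
  set b' := max b η with hb'
  have hb1 : OscLe D g R b' := fun x y h => (hb x y h).trans (le_max_left _ _)
  have hbη : η ≤ b' := le_max_right _ _
  have hb0 : 0 < b' := lt_of_lt_of_le hη (le_max_right _ _)
  have ht := H.sum.tendsto_atTop_zero
  have hev : ∀ᶠ n in atTop, ε n < η / 2 / b' := ht.eventually_lt_const (by positivity)
  obtain ⟨m, hm, hmk⟩ := (hev.and (eventually_ge_atTop k)).exists
  have h2 := H.step (n := m) (show η / 2 ≤ b' by linarith) (hk.anti ?_) hb1
  · refine ⟨m, fun x y hxy => (h2 x y hxy).trans ?_⟩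
    rw [lt_div_iff₀ hb0] at hm
    have := H.eps0 m
    nlinarith
  · have : r ^ (m + 1) ≤ r ^ k := pow_le_pow_of_le_one H.r0.le H.r1.le (by omega)
    exact mul_le_mul_of_nonneg_right this H.R0.le

theorem GoodIFS.osc_tendsto (H : GoodIFS p W D r R δ ε) {f : X → ℝ} {b : ℝ} (hb0 : 0 < b)
    (hb : OscLe D f R b) (hf : ScaleUC D r R f) {η : ℝ} (hη : 0 < η) :
    ∃ n0, ∀ n ≥ n0, OscLe D ((ifsOp p W)^[n] f) R η := by
  have huc : ∀ n, ScaleUC D r R ((ifsOp p W)^[n] f) := by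
    intro n
    induction n with
    | zero => exact hf
    | succ n ih => rw [Function.iterate_succ_apply']; exact H.scaleUC (H.mono_iter hb n) ih
  set c := Real.exp (-((∑' k, ε k) / δ)) with hc
  have hc0 : 0 < c := Real.exp_pos _
  have hc1 : c ≤ 1 := (H.prod_lb 0).trans (by simp)
  have main : ∀ m : ℕ, ∃ n, OscLe D ((ifsOp p W)^[n] f) R ((1 - c / 2) ^ m * b) := by
    intro m
    induction m with
    | zero => exact ⟨0, by simpa using hb⟩
    | succ m ih =>
      obtain ⟨n, hn⟩ := ih
      set b' := (1 - c / 2) ^ m * b with hb'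
      have hb'0 : 0 < b' := mul_pos (pow_pos (by linarith) _) hb0
      obtain ⟨k, hk⟩ := huc n (b' / 2) (by linarith)
      have h1 := H.iter (show b' / 2 ≤ b' by linarith) hn k 0 (by simpa using hk)
      refine ⟨k + n, ?_⟩
      rw [Function.iterate_add_apply]
      intro x y hxy
      refine (h1 x y (by simpa using hxy)).trans ?_
      have h2 := H.prod_lb k
      simp only [zero_add]
      have e : (1 - c / 2) ^ (m + 1) * b = b' - c * (b' - b' / 2) := by
        rw [hb', pow_succ]; ring
      rw [e]
      have : 0 ≤ b' - b' / 2 := by linarith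
      have := mul_le_mul_of_nonneg_right h2 this
      linarith
  have ht : Tendsto (fun m : ℕ => (1 - c / 2) ^ m * b) atTop (𝓝 (0 * b)) :=
    (tendsto_pow_atTop_nhds_zero_of_lt_one (by linarith) (by linarith)).mul_const b
  rw [zero_mul] at ht
  obtain ⟨m, hm⟩ := (ht.eventually_lt_const hη).exists
  obtain ⟨n0, hn0⟩ := main m
  refine ⟨n0, fun n hn => ?_⟩
  obtain ⟨k, rfl⟩ := Nat.exists_eq_add_of_le' hn
  rw [Function.iterate_add_apply]
  exact fun x y h => ((H.mono_iter hn0 k) x y h).trans hm.le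

end abstractIFS

lemma dini_summable {φ : ℝ → ℝ} (hm : MonotoneOn φ (Set.Ici 0)) (h0 : φ 0 = 0)
    (hi : IntervalIntegrable (fun t => φ t / t) volume 0 1) {r R : ℝ} (hr0 : 0 < r) (hr1 : r < 1)
    (hR : 0 < R) : Summable (fun n : ℕ => φ (r ^ n * R)) := by
  have hpos : ∀ t, 0 ≤ t → 0 ≤ φ t := fun t ht => by
    rw [← h0]; exact hm (Set.mem_Ici.2 le_rfl) (Set.mem_Ici.2 ht) ht
  have hsub : ∀ a b, 0 ≤ a → a ≤ 1 → 0 ≤ b → b ≤ 1 →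
      IntervalIntegrable (fun t => φ t / t) volume a b := by
    intro a b ha ha' hb hb'
    apply hi.mono_set
    rw [Set.uIcc_of_le zero_le_one]
    exact Set.uIcc_subset_Icc ⟨ha, ha'⟩ ⟨hb, hb'⟩
  have hp0 : ∀ n : ℕ, 0 < r ^ n := fun n => pow_pos hr0 n
  have hp1 : ∀ n : ℕ, r ^ n ≤ 1 := fun n => pow_le_one₀ hr0.le hr1.le
  have hone : ∀ n : ℕ, φ (r ^ (n + 1)) * (1 - r) ≤ ∫ t in (r ^ (n + 1))..(r ^ n), φ t / t := by
    intro n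
    have hle : r ^ (n + 1) ≤ r ^ n := pow_le_pow_of_le_one hr0.le hr1.le (by omega)
    have h1 : ∫ t in (r ^ (n + 1))..(r ^ n), φ (r ^ (n + 1)) / r ^ n
        ≤ ∫ t in (r ^ (n + 1))..(r ^ n), φ t / t := by
      apply intervalIntegral.integral_mono_on hle
      · exact intervalIntegrable_const
      · exact hsub _ _ (hp0 _).le (hp1 _) (hp0 _).le (hp1 _)
      · intro t ht
        have ht0 : 0 < t := lt_of_lt_of_le (hp0 _) ht.1
        have h2 : φ (r ^ (n + 1)) ≤ φ t :=
          hm (Set.mem_Ici.2 (hp0 _).le) (Set.mem_Ici.2 ht0.le) ht.1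
        exact div_le_div₀ (hpos _ ht0.le) h2 ht0 ht.2
    refine le_trans (le_of_eq ?_) h1
    rw [intervalIntegral.integral_const, smul_eq_mul, pow_succ]
    field_simp [(hp0 n).ne']
  have hs : Summable (fun n : ℕ => φ (r ^ (n + 1)) * (1 - r)) := by
    apply summable_of_sum_range_le (c := ∫ t in (0:ℝ)..1, φ t / t)
    · intro n
      exact mul_nonneg (hpos _ (hp0 _).le) (by linarith)
    · intro n
      have h1 : ∑ i ∈ Finset.range n, ∫ t in (r ^ (i + 1))..(r ^ i), φ t / t
          = ∫ t in (r ^ n)..1, φ t / t := by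
        have := intervalIntegral.sum_integral_adjacent_intervals (f := fun t => φ t / t)
          (μ := volume) (a := fun k : ℕ => r ^ k) (n := n)
          (fun k _ => hsub _ _ (hp0 _).le (hp1 _) (hp0 _).le (hp1 _))
        rw [intervalIntegral.integral_symm, ← pow_zero r, ← this, ← Finset.sum_neg_distrib]
        refine Finset.sum_congr rfl fun i _ => ?_
        rw [intervalIntegral.integral_symm]
      refine (Finset.sum_le_sum fun i _ => hone i).trans ?_
      rw [h1, ← intervalIntegral.integral_add_adjacent_intervals
        (hsub 0 (r ^ n) le_rfl zero_le_one (hp0 _).le (hp1 _))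
        (hsub (r ^ n) 1 (hp0 _).le (hp1 _) zero_le_one le_rfl)]
      have : 0 ≤ ∫ t in (0:ℝ)..(r ^ n), φ t / t := by
        apply intervalIntegral.integral_nonneg (hp0 _).le
        intro t ht
        exact div_nonneg (hpos _ ht.1) ht.1
      linarith
  have hs' : Summable (fun n : ℕ => φ (r ^ (n + 1))) := by
    rw [summable_mul_right_iff (by linarith)] at hs
    exact hs
  have ht : Tendsto (fun m : ℕ => r ^ m * R) atTop (𝓝 (0 * R)) :=
    (tendsto_pow_atTop_nhds_zero_of_lt_one hr0.le hr1).mul_const R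
  rw [zero_mul] at ht
  obtain ⟨k, hk⟩ := (ht.eventually_lt_const one_pos).exists
  rw [← summable_nat_add_iff (k + 1)]
  refine Summable.of_nonneg_of_le (fun n => hpos _ (mul_pos (hp0 _) hR).le) (fun n => ?_) hs'
  apply hm (Set.mem_Ici.2 (mul_pos (hp0 _) hR).le) (Set.mem_Ici.2 (hp0 _).le)
  have : r ^ (n + (k + 1)) * R = r ^ (n + 1) * (r ^ k * R) := by ring
  rw [this]
  exact mul_le_of_le_one_right (hp0 _).le hk.le

lemma dini_continuous {X : Type*} [PseudoMetricSpace X] {q : X → ℝ} (hq : DiniContinuous q) :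
    Continuous q := by
  obtain ⟨φ, hm, h0, hi, hφ⟩ := hq
  have hs := (dini_summable hm h0 hi (r := 1 / 2) (R := 1) (by norm_num) (by norm_num)
    one_pos).tendsto_atTop_zero
  rw [Metric.continuous_iff]
  intro x η hη
  obtain ⟨n, hn⟩ := (hs.eventually_lt_const hη).exists
  refine ⟨(1 / 2) ^ n * 1, by positivity, fun y hy => ?_⟩
  rw [Real.dist_eq]
  exact ((hφ y x).trans (hm dist_nonneg (Set.mem_Ici.2 (by positivity)) hy.le)).trans_lt hn

open scoped Matrix.Norms.L2Operator in
lemma schur_pow {d : ℕ} (A : Matrix (Fin d) (Fin d) ℝ) (hA : IsSchur A) :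
    ∃ r : ℝ, 0 < r ∧ r < 1 ∧ ∃ m : ℕ, 0 < m ∧ ‖A ^ m‖ ≤ r ^ m := by
  set a : Matrix (Fin d) (Fin d) ℂ := A.map (fun x : ℝ => (x : ℂ)) with ha
  have hrad : spectralRadius ℂ a < 1 := by
    rcases (spectrum ℂ a).eq_empty_or_nonempty with h | h
    · simp [spectralRadius, h]
    · have := spectrum.spectralRadius_lt_of_forall_lt_of_nonempty (r := 1) h
        (fun k hk => by exact_mod_cast hA k hk)
      simpa using this
  obtain ⟨s, hs1, hs2⟩ := ENNReal.lt_iff_exists_nnreal_btwn.1 hrad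
  have hs2' : s < 1 := by exact_mod_cast hs2
  have hg := spectrum.pow_nnnorm_pow_one_div_tendsto_nhds_spectralRadius a
  have hev : ∀ᶠ n : ℕ in atTop, ‖a ^ n‖ ≤ (s : ℝ) ^ n := by
    filter_upwards [hg.eventually_lt_const hs1, eventually_gt_atTop 0] with n hn hn0
    have h1 := ENNReal.rpow_le_rpow hn.le (Nat.cast_nonneg (α := ℝ) n)
    rw [← ENNReal.rpow_mul, one_div, inv_mul_cancel₀ (by positivity), ENNReal.rpow_one,
      ENNReal.rpow_natCast] at h1
    exact_mod_cast h1
  obtain ⟨r, hr1, hr2⟩ := exists_between (show max (s : ℝ) (1 / 2) < 1 from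
    max_lt (by exact_mod_cast hs2') (by norm_num))
  have hsr : (s : ℝ) < r := (le_max_left _ _).trans_lt hr1
  have hr0 : 0 < r := lt_of_lt_of_le (by norm_num) ((le_max_right _ _).trans hr1.le)
  refine ⟨r, hr0, hr2, ?_⟩
  have hq : Tendsto (fun n : ℕ => ((s : ℝ) / r) ^ n) atTop (𝓝 0) :=
    tendsto_pow_atTop_nhds_zero_of_lt_one (by positivity) ((div_lt_one hr0).2 hsr)
  have hz : Tendsto (fun n : ℕ => ((r : ℂ) ^ n)⁻¹ • a ^ n) atTop (𝓝 0) := by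
    apply squeeze_zero_norm' _ hq
    filter_upwards [hev] with n hn
    rw [norm_smul, norm_inv, norm_pow, Complex.norm_real, Real.norm_of_nonneg hr0.le, div_pow,
      div_eq_inv_mul]
    gcongr
  have hz' : Tendsto (fun n : ℕ => (r ^ n)⁻¹ • A ^ n) atTop (𝓝 0) := by
    have hc : Continuous (fun M : Matrix (Fin d) (Fin d) ℂ => M.map Complex.re) := by fun_prop
    have := (hc.tendsto 0).comp hz
    have e0 : (0 : Matrix (Fin d) (Fin d) ℂ).map Complex.re = 0 := by ext; simp
    rw [e0] at this
    refine this.congr fun n => ?_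
    have e1 : a ^ n = (A ^ n).map (fun x : ℝ => (x : ℂ)) := by
      have := (map_pow (Complex.ofRealHom.mapMatrix : Matrix (Fin d) (Fin d) ℝ →+* _) A n)
      exact this.symm
    ext i j
    simp only [Function.comp, e1, Matrix.map_apply, Matrix.smul_apply, smul_eq_mul]
    rw [← Complex.ofReal_pow, ← Complex.ofReal_inv, ← Complex.ofReal_mul, Complex.ofReal_re]
  obtain ⟨m, hm, hmpos⟩ := ((hz'.norm.eventually_lt_const
    (show ‖(0 : Matrix (Fin d) (Fin d) ℝ)‖ < 1 by simp)).and (eventually_gt_atTop 0)).exists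
  refine ⟨m, hmpos, ?_⟩
  rw [norm_smul, norm_inv, norm_pow, Real.norm_of_nonneg hr0.le, inv_mul_lt_iff₀ (by positivity)] at hm
  linarith

lemma adapted_norm {d : ℕ} (A : Matrix (Fin d) (Fin d) ℝ) (hA : IsSchur A) :
    ∃ (r : ℝ) (N : EuclideanSpace ℝ (Fin d) → ℝ), 0 < r ∧ r < 1 ∧ Continuous N ∧
      (∀ x, ‖x‖ ≤ N x) ∧ (∀ x, N (-x) = N x) ∧ N 0 = 0 ∧ (∀ x y, N (x + y) ≤ N x + N y) ∧
      (∀ x, N (Matrix.toEuclideanLin A x) ≤ r * N x) := by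
  obtain ⟨r, hr0, hr1, m, hmpos, hm0⟩ := schur_pow A hA
  set T := Matrix.toEuclideanCLM (𝕜 := ℝ) A with hT
  have hTA : ∀ x, Matrix.toEuclideanLin A x = T x := fun x => rfl
  have hm : ‖T ^ m‖ ≤ r ^ m := by
    rw [hT, ← map_pow]; exact hm0
  refine ⟨r, fun x => ∑ k ∈ Finset.range m, (r ^ k)⁻¹ * ‖(T ^ k) x‖, hr0, hr1, by fun_prop,
    ?_, ?_, ?_, ?_, ?_⟩
  · intro x
    have := Finset.single_le_sum (f := fun k => (r ^ k)⁻¹ * ‖(T ^ k) x‖)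
      (s := Finset.range m) (fun k _ => by positivity) (Finset.mem_range.2 hmpos)
    simpa using this
  · intro x; simp
  · simp
  · intro x y
    rw [← Finset.sum_add_distrib]
    apply Finset.sum_le_sum
    intro k _
    rw [map_add, ← mul_add]
    gcongr
    exact norm_add_le _ _
  · intro x
    simp only [hTA]
    have e : ∑ k ∈ Finset.range m, (r ^ k)⁻¹ * ‖(T ^ k) (T x)‖
        = r * ∑ k ∈ Finset.range m, (r ^ (k + 1))⁻¹ * ‖(T ^ (k + 1)) x‖ := by
      rw [Finset.mul_sum]
      refine Finset.sum_congr rfl fun k _ => ?_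
      rw [pow_succ T k, pow_succ r k]
      simp only [mul_apply_eq_comp]
      field_simp
    rw [e]
    apply mul_le_mul_of_nonneg_left _ hr0.le
    have h1 := Finset.sum_range_succ (fun k => (r ^ k)⁻¹ * ‖(T ^ k) x‖) m
    have h2 := Finset.sum_range_succ' (fun k => (r ^ k)⁻¹ * ‖(T ^ k) x‖) m
    have h3 : (r ^ m)⁻¹ * ‖(T ^ m) x‖ ≤ ‖x‖ := by
      rw [inv_mul_le_iff₀ (by positivity)]
      exact (T ^ m).le_of_opNorm_le hm x
    simp only [pow_zero, inv_one, one_mul, one_apply_eq_self] at h2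
    linarith

section measureIFS

variable {X : Type*} [MeasurableSpace X] {L : ℕ} {p : Fin L → X → ℝ} {W : Fin L → X → X}

lemma ifs_measurable (hp : ∀ i, Measurable (p i)) (hW : ∀ i, Measurable (W i)) :
    Measurable (IFSKernel p W) := by
  apply Measure.measurable_of_measurable_coe
  intro s hs
  simp only [IFSKernel, Measure.coe_finsetSum, Finset.sum_apply, Measure.smul_apply, smul_eq_mul]
  refine Finset.measurable_sum _ fun i _ => ?_
  refine (hp i).ennreal_ofReal.mul ?_
  exact (Measure.measurable_coe hs).comp (Measure.measurable_dirac.comp (hW i))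

lemma ifs_prob (hp0 : ∀ i x, 0 ≤ p i x) (hsum : ∀ x, ∑ i, p i x = 1) (x : X) :
    IsProbabilityMeasure (IFSKernel p W x) := by
  constructor
  simp only [IFSKernel, Measure.coe_finsetSum, Finset.sum_apply, Measure.smul_apply, smul_eq_mul,
    measure_univ, mul_one]
  rw [← ENNReal.ofReal_sum_of_nonneg (fun i _ => hp0 i x), hsum, ENNReal.ofReal_one]

lemma ifs_integral (hp0 : ∀ i x, 0 ≤ p i x) {g : X → ℝ} (hg : Measurable g)
    (x : X) : ∫ y, g y ∂(IFSKernel p W x) = ifsOp p W g x := by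
  unfold IFSKernel ifsOp
  rw [integral_finsetSum_measure]
  · refine Finset.sum_congr rfl fun i _ => ?_
    rw [integral_smul_measure, integral_dirac' _ _ hg.stronglyMeasurable,
      ENNReal.toReal_ofReal (hp0 i x), smul_eq_mul]
  · intro i _
    refine Integrable.smul_measure ?_ ENNReal.ofReal_ne_top
    exact integrable_dirac' hg.stronglyMeasurable (by simp)

lemma ifs_bind_prob (hp : ∀ i, Measurable (p i)) (hW : ∀ i, Measurable (W i))
    (hp0 : ∀ i x, 0 ≤ p i x) (hsum : ∀ x, ∑ i, p i x = 1)
    (ν : Measure X) [IsProbabilityMeasure ν] : IsProbabilityMeasure (ν.bind (IFSKernel p W)) := by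
  have := ifs_prob (W := W) hp0 hsum
  constructor
  rw [Measure.bind_apply MeasurableSet.univ (ifs_measurable hp hW).aemeasurable]
  simp

lemma ifs_integral_bind (hp : ∀ i, Measurable (p i)) (hW : ∀ i, Measurable (W i))
    (hp0 : ∀ i x, 0 ≤ p i x) (hsum : ∀ x, ∑ i, p i x = 1)
    (ν : Measure X) [IsProbabilityMeasure ν] {g : X → ℝ} (hg : Measurable g) {C : ℝ}
    (hC : ∀ x, |g x| ≤ C) :
    ∫ y, g y ∂(ν.bind (IFSKernel p W)) = ∫ x, ifsOp p W g x ∂ν := by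
  let η : ProbabilityTheory.Kernel X X := ⟨IFSKernel p W, ifs_measurable hp hW⟩
  have hb := ifs_bind_prob hp hW hp0 hsum ν
  have h := ProbabilityTheory.Kernel.integral_comp (η := η)
    (κ := ProbabilityTheory.Kernel.const Unit ν) (a := ()) (f := g) (by
      rw [ProbabilityTheory.Kernel.comp_apply, ProbabilityTheory.Kernel.const_apply]
      change Integrable g (ν.bind (IFSKernel p W))
      exact Integrable.of_bound hg.aestronglyMeasurable C (ae_of_all _ hC))
  rw [ProbabilityTheory.Kernel.comp_apply, ProbabilityTheory.Kernel.const_apply] at h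
  refine h.trans ?_
  refine integral_congr_ae (ae_of_all _ fun x => ?_)
  exact ifs_integral hp0 hg x

lemma ifsOp_bound (hp0 : ∀ i x, 0 ≤ p i x) (hsum : ∀ x, ∑ i, p i x = 1) {g : X → ℝ} {c C : ℝ}
    {S : Set X} (hS : ∀ i, ∀ x ∈ S, W i x ∈ S)
    (hC : ∀ x ∈ S, |g x - c| ≤ C) : ∀ x ∈ S, |ifsOp p W g x - c| ≤ C := by
  intro x hx
  have : ifsOp p W g x - c = ∑ i, p i x * (g (W i x) - c) := by
    simp only [mul_sub, Finset.sum_sub_distrib, ← Finset.sum_mul, hsum, one_mul, ifsOp]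
  rw [this]
  refine (Finset.abs_sum_le_sum_abs _ _).trans ?_
  calc ∑ i, |p i x * (g (W i x) - c)| ≤ ∑ i, p i x * C := by
        refine Finset.sum_le_sum fun i _ => ?_
        rw [abs_mul, abs_of_nonneg (hp0 i x)]
        exact mul_le_mul_of_nonneg_left (hC _ (hS i x hx)) (hp0 i x)
    _ = C := by rw [← Finset.sum_mul, hsum, one_mul]

lemma ifsOp_bound_iter (hp0 : ∀ i x, 0 ≤ p i x) (hsum : ∀ x, ∑ i, p i x = 1) {g : X → ℝ} {c C : ℝ}
    {S : Set X} (hS : ∀ i, ∀ x ∈ S, W i x ∈ S)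
    (hC : ∀ x ∈ S, |g x - c| ≤ C) (n : ℕ) : ∀ x ∈ S, |(ifsOp p W)^[n] g x - c| ≤ C := by
  induction n with
  | zero => exact hC
  | succ n ih => rw [Function.iterate_succ_apply']; exact ifsOp_bound hp0 hsum hS ih

lemma ifsOp_bound_iter' (hp0 : ∀ i x, 0 ≤ p i x) (hsum : ∀ x, ∑ i, p i x = 1) {g : X → ℝ} {C : ℝ}
    (hC : ∀ x, |g x| ≤ C) (n : ℕ) (x : X) : |(ifsOp p W)^[n] g x| ≤ C := by
  have := ifsOp_bound_iter (W := W) (S := Set.univ) (c := 0) (g := g) (C := C) hp0 hsum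
    (by simp) (by simpa using hC) n x trivial
  simpa using this

lemma ifsOp_measurable (hp : ∀ i, Measurable (p i)) (hW : ∀ i, Measurable (W i)) {g : X → ℝ}
    (hg : Measurable g) : Measurable (ifsOp p W g) :=
  Finset.measurable_sum _ fun i _ => (hp i).mul (hg.comp (hW i))

lemma ifsOp_measurable_iter (hp : ∀ i, Measurable (p i)) (hW : ∀ i, Measurable (W i)) {g : X → ℝ}
    (hg : Measurable g) (n : ℕ) : Measurable ((ifsOp p W)^[n] g) := by
  induction n with
  | zero => exact hg
  | succ n ih => rw [Function.iterate_succ_apply']; exact ifsOp_measurable hp hW ih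

lemma ifs_iter_prob (hp : ∀ i, Measurable (p i)) (hW : ∀ i, Measurable (W i))
    (hp0 : ∀ i x, 0 ≤ p i x) (hsum : ∀ x, ∑ i, p i x = 1)
    (ν : Measure X) [IsProbabilityMeasure ν] (n : ℕ) :
    IsProbabilityMeasure ((fun m : Measure X => m.bind (IFSKernel p W))^[n] ν) := by
  induction n with
  | zero => assumption
  | succ n ih => rw [Function.iterate_succ_apply']; exact ifs_bind_prob hp hW hp0 hsum _

lemma ifs_integral_iter (hp : ∀ i, Measurable (p i)) (hW : ∀ i, Measurable (W i))
    (hp0 : ∀ i x, 0 ≤ p i x) (hsum : ∀ x, ∑ i, p i x = 1)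
    (ν : Measure X) [IsProbabilityMeasure ν] (n : ℕ) : ∀ {g : X → ℝ} (_ : Measurable g) {C : ℝ}
    (_ : ∀ x, |g x| ≤ C),
    ∫ y, g y ∂((fun m : Measure X => m.bind (IFSKernel p W))^[n] ν)
      = ∫ x, (ifsOp p W)^[n] g x ∂ν := by
  induction n with
  | zero => intros; rfl
  | succ n ih =>
    intro g hg C hC
    have := ifs_iter_prob hp hW hp0 hsum ν n
    rw [Function.iterate_succ_apply', ifs_integral_bind hp hW hp0 hsum _ hg hC,
      ih (ifsOp_measurable hp hW hg) (C := C), Function.iterate_succ_apply]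
    exact ifsOp_bound_iter' hp0 hsum hC 1

lemma ifs_iter_supp (hp : ∀ i, Measurable (p i)) (hW : ∀ i, Measurable (W i))
    {S : Set X} (hSm : MeasurableSet S) (hS : ∀ i, ∀ x ∈ S, W i x ∈ S)
    (ν : Measure X) (hν : ν Sᶜ = 0) (n : ℕ) :
    ((fun m : Measure X => m.bind (IFSKernel p W))^[n] ν) Sᶜ = 0 := by
  induction n with
  | zero => exact hν
  | succ n ih =>
    rw [Function.iterate_succ_apply', Measure.bind_apply hSm.compl
      (ifs_measurable hp hW).aemeasurable, lintegral_eq_zero_iff (show Measurable (fun a => IFSKernel p W a Sᶜ) from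
      (Measure.measurable_coe hSm.compl).comp (ifs_measurable hp hW))]
    have hae : ∀ᵐ x ∂((fun m : Measure X => m.bind (IFSKernel p W))^[n] ν), x ∈ S := ih
    filter_upwards [hae] with x hx
    simp only [IFSKernel, Measure.coe_finsetSum, Finset.sum_apply, Measure.smul_apply, smul_eq_mul,
      Pi.zero_apply]
    refine Finset.sum_eq_zero fun i _ => ?_
    rw [Measure.dirac_apply' _ hSm.compl]
    simp [hS i x hx]

/-- Assembling: pointwise asymptotic stability implies the theorem. -/
theorem ifs_conclude {X : Type*} [MeasurableSpace X] [MetricSpace X] [BorelSpace X]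
    {p : Fin L → X → ℝ} {W : Fin L → X → X}
    (hp : ∀ i, Continuous (p i)) (hW : ∀ i, Continuous (W i))
    (hp0 : ∀ i x, 0 ≤ p i x) (hsum : ∀ x, ∑ i, p i x = 1)
    {S : Set X} (hSc : IsCompact S) (hS : ∀ i, ∀ x ∈ S, W i x ∈ S) (x0 : X) (hx0 : x0 ∈ S)
    (hA : ∀ f : X → ℝ, (∃ C, ∀ x, |f x| ≤ C) → (∃ K, LipschitzWith K f) → ∀ x, ∀ η > 0,
      ∃ n0, ∀ n ≥ n0, |(ifsOp p W)^[n] f x - (ifsOp p W)^[n] f x0| ≤ η)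
    (hB : ∀ f : X → ℝ, (∃ C, ∀ x, |f x| ≤ C) → (∃ K, LipschitzWith K f) → ∀ η > 0,
      ∃ n0, ∀ n ≥ n0, ∀ k ≥ n, |(ifsOp p W)^[k] f x0 - (ifsOp p W)^[n] f x0| ≤ η) :
    ∃ μstar : Measure X,
      (IsProbabilityMeasure μstar ∧ Invariant (IFSKernel p W) μstar) ∧
      (∀ μ : Measure X, IsProbabilityMeasure μ → Invariant (IFSKernel p W) μ → μ = μstar) ∧
      Attractive (IFSKernel p W) μstar := by
  have hpm : ∀ i, Measurable (p i) := fun i => (hp i).measurable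
  have hWm : ∀ i, Measurable (W i) := fun i => (hW i).measurable
  let it : Measure X → ℕ → Measure X :=
    fun ν n => (fun m : Measure X => m.bind (IFSKernel p W))^[n] ν
  have hit : ∀ (ν : Measure X) [IsProbabilityMeasure ν] n, IsProbabilityMeasure (it ν n) :=
    fun ν _ n => ifs_iter_prob hpm hWm hp0 hsum ν n
  let ν0 : ℕ → ProbabilityMeasure X := fun n => ⟨it (Measure.dirac x0) n, hit _ n⟩
  have htight : IsCompact (closure (Set.range ν0)) := by
    apply isCompact_closure_of_isTightMeasureSet
    rw [isTightMeasureSet_iff_exists_isCompact_measure_compl_le]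
    intro ε hε
    refine ⟨S, hSc, ?_⟩
    rintro μ ⟨ν, ⟨n, rfl⟩, rfl⟩
    refine le_of_eq_of_le ?_ zero_le
    refine ifs_iter_supp hpm hWm hSc.measurableSet hS _ ?_ n
    rw [Measure.dirac_apply' _ hSc.measurableSet.compl]
    simp [hx0]
  obtain ⟨μ, -, hμ⟩ := htight.ultrafilter_le_nhds ((Filter.hyperfilter ℕ).map ν0) (by
    rw [Filter.le_principal_iff]
    exact Filter.mem_of_superset (Filter.mem_map.2 (Filter.univ_mem' fun n => Set.mem_range_self n))
      subset_closure)
  have hμ' : Tendsto ν0 (Filter.hyperfilter ℕ : Filter ℕ) (𝓝 μ) := hμ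
  have hle : (Filter.hyperfilter ℕ : Filter ℕ) ≤ atTop := by
    rw [← Nat.cofinite_eq_atTop]; exact Filter.hyperfilter_le_cofinite
  rw [ProbabilityMeasure.tendsto_iff_forall_integral_tendsto] at hμ'
  -- pointwise convergence
  have hpt : ∀ f : X → ℝ, (∃ C, ∀ x, |f x| ≤ C) → (∃ K, LipschitzWith K f) →
      ∀ x, Tendsto (fun n => (ifsOp p W)^[n] f x) atTop (𝓝 (∫ y, f y ∂(μ : Measure X))) := by
    intro f hf hl x
    obtain ⟨C, hC⟩ := hf
    have hfc : Continuous f := hl.choose_spec.continuous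
    let F : BoundedContinuousFunction X ℝ :=
      BoundedContinuousFunction.ofNormedAddCommGroup f hfc C hC
    have h1 : Tendsto (fun n => (ifsOp p W)^[n] f x0) (Filter.hyperfilter ℕ : Filter ℕ)
        (𝓝 (∫ y, f y ∂(μ : Measure X))) := by
      refine (hμ' F).congr fun n => ?_
      have := ifs_integral_iter hpm hWm hp0 hsum (Measure.dirac x0) n hfc.measurable hC
      rw [integral_dirac] at this
      exact this
    rw [Metric.tendsto_atTop]
    intro η hη
    obtain ⟨n1, hn1⟩ := hA f ⟨C, hC⟩ hl x (η / 3) (by linarith)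
    obtain ⟨n2, hn2⟩ := hB f ⟨C, hC⟩ hl (η / 3) (by linarith)
    refine ⟨max n1 n2, fun n hn => ?_⟩
    have a1 := hn1 n ((le_max_left _ _).trans hn)
    have a2 : |(∫ y, f y ∂(μ : Measure X)) - (ifsOp p W)^[n] f x0| ≤ η / 3 := by
      refine le_of_tendsto (h1.sub_const _).abs ?_
      exact hle ((eventually_ge_atTop n).mono fun k hk =>
        hn2 n ((le_max_right _ _).trans hn) k hk)
    rw [Real.dist_eq]
    rw [abs_le] at a1 a2
    rw [abs_lt]
    constructor <;> linarith [a1.1, a1.2, a2.1, a2.2]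
  let itP : ∀ (ν : Measure X) [IsProbabilityMeasure ν], ℕ → ProbabilityMeasure X :=
    fun ν _ n => ⟨it ν n, hit ν n⟩
  have hattr : ∀ (ν : Measure X) [IsProbabilityMeasure ν],
      Tendsto (itP ν) atTop (𝓝 μ) := by
    intro ν _
    rw [tendsto_iff_forall_lipschitz_integral_tendsto]
    intro f hfb hl
    have hfb' : ∃ C, ∀ x, |f x| ≤ C := by
      obtain ⟨C, hC⟩ := hfb
      refine ⟨C + |f x0|, fun x => ?_⟩
      have := hC x x0
      rw [Real.dist_eq] at this
      have := abs_sub_abs_le_abs_sub (f x) (f x0)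
      linarith
    have hfm : Measurable f := hl.choose_spec.continuous.measurable
    obtain ⟨C, hC⟩ := hfb'
    have e : ∀ n, ∫ y, f y ∂(it ν n) = ∫ x, (ifsOp p W)^[n] f x ∂ν :=
      fun n => ifs_integral_iter hpm hWm hp0 hsum ν n hfm hC
    change Tendsto (fun n => ∫ y, f y ∂(it ν n)) _ _
    simp_rw [e]
    have hlim : ∫ y, f y ∂(μ : Measure X) = ∫ _x, (∫ y, f y ∂(μ : Measure X)) ∂ν := by simp
    rw [hlim]
    refine tendsto_integral_of_dominated_convergence (fun _ => C) ?_ (integrable_const _) ?_ ?_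
    · exact fun n => (ifsOp_measurable_iter hpm hWm hfm n).aestronglyMeasurable
    · exact fun n => ae_of_all _ fun x => ifsOp_bound_iter' hp0 hsum hC n x
    · exact ae_of_all _ fun x => hpt f ⟨C, hC⟩ hl x
  have hattr' : Attractive (IFSKernel p W) (μ : Measure X) := by
    intro ν hν f
    exact (ProbabilityMeasure.tendsto_iff_forall_integral_tendsto.1 (hattr ν)) f
  refine ⟨μ, ⟨inferInstance, ?_⟩, ?_, hattr'⟩
  · have := ifs_bind_prob hpm hWm hp0 hsum (μ : Measure X)
    refine ext_of_forall_integral_eq_of_IsFiniteMeasure fun f => ?_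
    have hfb : ∀ x, |f x| ≤ ‖f‖ := fun x => f.norm_coe_le_norm x
    rw [ifs_integral_bind hpm hWm hp0 hsum _ f.continuous.measurable hfb]
    have hPc : Continuous (ifsOp p W f) :=
      continuous_finsetSum _ fun i _ => (hp i).mul (f.continuous.comp (hW i))
    let F : BoundedContinuousFunction X ℝ :=
      BoundedContinuousFunction.ofNormedAddCommGroup (ifsOp p W f) hPc ‖f‖
        (ifsOp_bound_iter' hp0 hsum hfb 1)
    have h1 := hattr' μ inferInstance F
    have h2 := (tendsto_add_atTop_iff_nat 1).2 (hattr' μ inferInstance f)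
    refine tendsto_nhds_unique (h1.congr fun n => ?_) h2
    have := ifs_iter_prob hpm hWm hp0 hsum (μ : Measure X) n
    rw [Function.iterate_succ_apply',
      ifs_integral_bind hpm hWm hp0 hsum _ f.continuous.measurable hfb]
    rfl
  · intro ν hν hinv
    refine ext_of_forall_integral_eq_of_IsFiniteMeasure fun f => ?_
    have h1 := hattr' ν hν f
    have e : ∀ n, (fun m : Measure X => m.bind (IFSKernel p W))^[n] ν = ν :=
      fun n => Function.iterate_fixed (show ν.bind (IFSKernel p W) = ν from hinv) n
    simp only [e] at h1
    exact tendsto_nhds_unique tendsto_const_nhds h1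

end measureIFS

/-- Core affine iterated-random-function theorem: for a Schur matrix `𝒜`, affine maps
`W ℓ ξ = 𝒜 ξ + β ℓ` chosen with Dini continuous probabilities bounded below by `δ > 0`,
the associated Markov kernel has a unique invariant Borel probability measure, which is
moreover attractive. -/
theorem affine_IFS_unique_attractive_invariant_measure {d L : ℕ}
    (𝒜 : Matrix (Fin d) (Fin d) ℝ) (hA : IsSchur 𝒜)
    (β : Fin L → EuclideanSpace ℝ (Fin d))
    (W : Fin L → EuclideanSpace ℝ (Fin d) → EuclideanSpace ℝ (Fin d))
    (hW : ∀ ℓ ξ, W ℓ ξ = Matrix.toEuclideanLin 𝒜 ξ + β ℓ)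
    (p : Fin L → EuclideanSpace ℝ (Fin d) → ℝ)
    (hp01 : ∀ ℓ x, p ℓ x ∈ Set.Icc (0 : ℝ) 1)
    (hpDini : ∀ ℓ, DiniContinuous (p ℓ))
    (hpsum : ∀ x, ∑ ℓ, p ℓ x = 1)
    (δ : ℝ) (hδ : 0 < δ) (hplb : ∀ ℓ x, δ ≤ p ℓ x) :
    ∃ μstar : Measure (EuclideanSpace ℝ (Fin d)),
      (IsProbabilityMeasure μstar ∧ Invariant (IFSKernel p W) μstar) ∧
      (∀ μ : Measure (EuclideanSpace ℝ (Fin d)),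
        IsProbabilityMeasure μ → Invariant (IFSKernel p W) μ → μ = μstar) ∧
      Attractive (IFSKernel p W) μstar := by
  have hpc : ∀ i, Continuous (p i) := fun i => dini_continuous (hpDini i)
  have hWc : ∀ i, Continuous (W i) := by
    intro i
    have : W i = fun ξ => Matrix.toEuclideanLin 𝒜 ξ + β i := funext (hW i)
    rw [this]
    exact (LinearMap.continuous_of_finiteDimensional _).add continuous_const
  have hp0 : ∀ i x, 0 ≤ p i x := fun i x => (hp01 i x).1
  obtain ⟨r, N, hr0, hr1, hNc, hNn, hNneg, hN0, hNadd, hNA⟩ := adapted_norm 𝒜 hA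
  have hNpos : ∀ x, 0 ≤ N x := fun x => (norm_nonneg x).trans (hNn x)
  choose φ hφm hφ0 hφi hφ using hpDini
  have hφpos : ∀ i t, 0 ≤ t → 0 ≤ φ i t := fun i t ht => by
    rw [← hφ0 i]; exact hφm i (Set.mem_Ici.2 le_rfl) (Set.mem_Ici.2 ht) ht
  have hL : Nonempty (Fin L) := by
    by_contra h
    rw [not_nonempty_iff] at h
    simpa using hpsum 0
  obtain ⟨i0⟩ := hL
  have hδ1 : δ ≤ 1 := (hplb i0 0).trans (hp01 i0 0).2
  set B := ∑ i, N (β i) with hB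
  have hB0 : 0 ≤ B := Finset.sum_nonneg fun i _ => hNpos _
  have hβB : ∀ i, N (β i) ≤ B := fun i =>
    Finset.single_le_sum (f := fun i => N (β i)) (fun i _ => hNpos _) (Finset.mem_univ i)
  set R0 := 2 * B / (1 - r) + 1 with hR0
  have hRabs : ∀ R, R0 ≤ R → r * R + 2 * B ≤ R := by
    intro R hR
    have h1 : 2 * B / (1 - r) ≤ R := by linarith
    rw [div_le_iff₀ (by linarith)] at h1
    linarith
  have hR0pos : 0 < R0 := by
    have : 0 ≤ 2 * B / (1 - r) := div_nonneg (by linarith) (by linarith)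
    linarith
  have hsymm : ∀ x y : EuclideanSpace ℝ (Fin d), N (x - y) = N (y - x) := fun x y => by
    rw [← hNneg, neg_sub]
  have good : ∀ R, R0 ≤ R → GoodIFS p W (fun x y => N (x - y)) r R δ
      (fun n => min (∑ i, φ i (r ^ n * R)) (1 - δ)) := by
    intro R hR
    have hRpos : 0 < R := hR0pos.trans_le hR
    have hsc : ∀ n : ℕ, 0 < r ^ n * R := fun n => mul_pos (pow_pos hr0 n) hRpos
    have hs0 : ∀ n : ℕ, 0 ≤ ∑ i, φ i (r ^ n * R) := fun n =>
      Finset.sum_nonneg fun i _ => hφpos i _ (hsc n).le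
    refine ⟨hp0, hpsum, hsymm, hr0, hr1, hRpos, hδ, ?_, ?_, ?_, ?_, ?_, ?_⟩
    · intro i x y
      have : W i x - W i y = Matrix.toEuclideanLin 𝒜 (x - y) := by
        rw [hW, hW, map_sub]; abel
      simp only [this]
      exact hNA _
    · intro i j x y hxy
      have : W i x - W j y = Matrix.toEuclideanLin 𝒜 (x - y) + (β i + - β j) := by
        rw [hW, hW, map_sub]; abel
      simp only [this]
      have h1 := hNadd (Matrix.toEuclideanLin 𝒜 (x - y)) (β i + - β j)
      have h2 := hNadd (β i) (- β j)
      rw [hNneg] at h2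
      have h3 := hNA (x - y)
      have h4 := mul_le_mul_of_nonneg_left hxy hr0.le
      linarith [hβB i, hβB j, hRabs R hR]
    · intro n x y hxy
      apply le_min
      · rw [← hpsum x, ← Finset.sum_sub_distrib]
        refine Finset.sum_le_sum fun i _ => ?_
        have h1 : p i x - min (p i x) (p i y) ≤ |p i x - p i y| := by
          rcases min_cases (p i x) (p i y) with ⟨h, _⟩ | ⟨h, _⟩ <;> rw [h]
          · simp
          · exact le_abs_self _
        refine h1.trans ((hφ i x y).trans (hφm i dist_nonneg (Set.mem_Ici.2 (hsc n).le) ?_))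
        rw [dist_eq_norm]
        exact (hNn _).trans hxy
      · have := Finset.single_le_sum (f := fun i => min (p i x) (p i y))
          (fun i _ => le_min (hp0 i x) (hp0 i y)) (Finset.mem_univ i0)
        have h2 : δ ≤ min (p i0 x) (p i0 y) := le_min (hplb _ _) (hplb _ _)
        linarith
    · exact fun n => le_min (hs0 n) (by linarith)
    · exact fun n => min_le_right _ _
    · refine Summable.of_nonneg_of_le (fun n => le_min (hs0 n) (by linarith))
        (fun n => min_le_left _ _) ?_
      exact summable_sum fun i _ => dini_summable (hφm i) (hφ0 i) (hφi i) hr0 hr1 hRpos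
  have hosc : ∀ R, R0 ≤ R → ∀ f : EuclideanSpace ℝ (Fin d) → ℝ, (∃ C, ∀ x, |f x| ≤ C) →
      (∃ K, LipschitzWith K f) → ∀ η > 0,
      ∃ n0, ∀ n ≥ n0, OscLe (fun x y => N (x - y)) ((ifsOp p W)^[n] f) R η := by
    rintro R hR f ⟨C, hC⟩ ⟨K, hK⟩ η hη
    have hRpos : 0 < R := hR0pos.trans_le hR
    have hC0 : 0 ≤ C := (abs_nonneg _).trans (hC 0)
    refine (good R hR).osc_tendsto (b := 2 * C + 1) (by linarith) ?_ ?_ hη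
    · intro x y _
      have := abs_sub (f x) (f y)
      linarith [hC x, hC y]
    · intro η' hη'
      have ht : Tendsto (fun m : ℕ => (K : ℝ) * (r ^ m * R)) atTop (𝓝 (K * (0 * R))) :=
        ((tendsto_pow_atTop_nhds_zero_of_lt_one hr0.le hr1).mul_const R).const_mul _
      rw [zero_mul, mul_zero] at ht
      obtain ⟨k, hk⟩ := (ht.eventually_lt_const hη').exists
      refine ⟨k, fun x y hxy => ?_⟩
      have h1 := hK.dist_le_mul x y
      rw [Real.dist_eq, dist_eq_norm] at h1
      refine h1.trans (le_trans ?_ hk.le)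
      exact mul_le_mul_of_nonneg_left ((hNn _).trans hxy) K.2
  have hSabs : ∀ i, ∀ x ∈ {x | N x ≤ R0}, W i x ∈ {x | N x ≤ R0} := by
    intro i x hx
    change N x ≤ R0 at hx
    change N (W i x) ≤ R0
    rw [hW]
    have h1 := hNadd (Matrix.toEuclideanLin 𝒜 x) (β i)
    have h3 := hNA x
    have h4 := mul_le_mul_of_nonneg_left hx hr0.le
    linarith [hβB i, hRabs R0 le_rfl]
  have hx0 : (0 : EuclideanSpace ℝ (Fin d)) ∈ {x | N x ≤ R0} := by
    change N 0 ≤ R0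
    rw [hN0]; exact hR0pos.le
  refine ifs_conclude hpc hWc hp0 hpsum (S := {x | N x ≤ R0}) ?_ hSabs 0 hx0 ?_ ?_
  · refine (isCompact_closedBall (0 : EuclideanSpace ℝ (Fin d)) R0).of_isClosed_subset
      (isClosed_le hNc continuous_const) fun x hx => ?_
    rw [mem_closedBall_zero_iff]
    exact (hNn x).trans hx
  · intro f hf hl x η hη
    obtain ⟨n0, hn0⟩ := hosc (max R0 (N (x - 0))) (le_max_left _ _) f hf hl η hη
    exact ⟨n0, fun n hn => hn0 n hn x 0 (le_max_right _ _)⟩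
  · intro f hf hl η hη
    obtain ⟨n0, hn0⟩ := hosc R0 le_rfl f hf hl η hη
    refine ⟨n0, fun n hn k hk => ?_⟩
    obtain ⟨j, rfl⟩ := Nat.exists_eq_add_of_le' hk
    rw [Function.iterate_add_apply]
    refine ifsOp_bound_iter hp0 hpsum hSabs ?_ j 0 hx0
    intro x hx
    exact hn0 n hn x 0 (by simpa using hx)
end
end

section
/- (Theorem 2: interconnection of two ensembles with nonlinear contractive agents and stable linear controllers and filters.) Let n_S, n_C be natural numbers, and consider the state space ℝ^{n_S} × ℝ^{n_C}. For ℓ = 1, …, L let W_ℓ(x, z) = (w_ℓ(x), A z + g_ℓ(x)), where each w_ℓ : ℝ^{n_S} → ℝ^{n_S} is globally Lipschitz with Lipschitz constant l_ℓ < 1, each g_ℓ : ℝ^{n_S} → ℝ^{n_C} is globally Lipschitz, and A is an n_C×n_C real Schur matrix (encoding the stable linear controllers and filters). Let p₁, …, p_L : ℝ^{n_S} × ℝ^{n_C} → [0,1] be Dini continuous probability functions with Σ_ℓ p_ℓ(ξ) = 1 for all ξ, and suppose there exists δ > 0 with p_ℓ(ξ) ≥ δ for all ℓ and all ξ. Then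 the Markov kernel κ(ξ) = Σ_ℓ p_ℓ(ξ)·δ_{W_ℓ(ξ)} admits a unique invariant Borel probability measure, and this measure is attractive. -/
open MeasureTheory Filter Topology

noncomputable section

lemma aux_seq (a : ℕ → ℕ → ℝ) (σ : ℕ → ℝ) (h0 : ∀ k n, 0 ≤ a k n) (hk : ∀ k n, a k n ≤ a 0 n)
    (hσ0 : ∀ k, 0 ≤ σ k) (hσ1 : ∀ k, σ k < 1) (hs : Summable σ)
    (hrec : ∀ k n, a k (n+1) ≤ (1 - σ k) * a (k+1) n + σ k * a 0 n)
    (ha0 : Tendsto (fun k => a k 0) atTop (𝓝 0)) :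
    Tendsto (fun n => a 0 n) atTop (𝓝 0) := by
  have hanti : Antitone (fun n => a 0 n) := by
    refine antitone_nat_of_succ_le fun n => ?_
    have h1 := hrec 0 n
    have h2 := hk 1 n
    have h3 := hσ1 0
    nlinarith
  have hbdd : BddBelow (Set.range (fun n => a 0 n)) := ⟨0, by rintro _ ⟨n, rfl⟩; exact h0 0 n⟩
  have hlim := tendsto_atTop_ciInf hanti hbdd
  set α := ⨅ n, a 0 n with hα
  have hαle : ∀ n, α ≤ a 0 n := fun n => ciInf_le hbdd n
  have hα0 : 0 ≤ α := le_ciInf fun n => h0 0 n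
  have heq : ∀ n k, a k n ≤ a (k+n) 0 + a 0 0 * ∑ j ∈ Finset.range n, σ (k+j) := by
    intro n
    induction n with
    | zero => intro k; simp
    | succ n ih =>
      intro k
      have h1 := hrec k n
      have h2 := ih (k+1)
      rw [Finset.sum_range_succ']
      have h3 : a 0 n ≤ a 0 0 := hanti (Nat.zero_le n)
      have h4 : ∑ j ∈ Finset.range n, σ (k + (j+1)) = ∑ j ∈ Finset.range n, σ (k + 1 + j) :=
        Finset.sum_congr rfl fun j _ => by congr 1; omega
      have h5 : k + (n+1) = k + 1 + n := by omega
      rw [h4, h5, add_zero]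
      have h6 := mul_le_mul_of_nonneg_left h3 (hσ0 k)
      have h7 := mul_nonneg (hσ0 k) (h0 (k+1) n)
      nlinarith
  have hunif : ∀ ε > 0, ∃ N, ∀ n, a N n ≤ ε := by
    intro ε hε
    have t1 : ∀ᶠ N in atTop, a N 0 < ε/2 := ha0.eventually_lt_const (by linarith)
    have t2 : Tendsto (fun N => a 0 0 * ∑' j, σ (j + N)) atTop (𝓝 (a 0 0 * 0)) :=
      (tendsto_sum_nat_add σ).const_mul _
    rw [mul_zero] at t2
    have t3 : ∀ᶠ N in atTop, a 0 0 * ∑' j, σ (j + N) < ε/2 := t2.eventually_lt_const (by linarith)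
    obtain ⟨N1, hN1⟩ := eventually_atTop.1 t1
    obtain ⟨N, hN, hN3⟩ := ((eventually_ge_atTop N1).and t3).exists
    refine ⟨N, fun n => (heq n N).trans ?_⟩
    have h1 := hN1 (N+n) (by omega)
    have h2 : ∑ j ∈ Finset.range n, σ (N+j) ≤ ∑' j, σ (j+N) := by
      simp only [add_comm N]
      exact ((summable_nat_add_iff N).2 hs).sum_le_tsum _ (fun i _ => hσ0 _)
    have h3 := mul_le_mul_of_nonneg_left h2 (h0 0 0)
    linarith
  have hpos : ∀ N k, 0 < ∏ j ∈ Finset.range N, (1 - σ (k+j)) := fun N k =>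
    Finset.prod_pos fun j _ => by linarith [hσ1 (k+j)]
  have hle1 : ∀ N k, ∏ j ∈ Finset.range N, (1 - σ (k+j)) ≤ 1 := fun N k =>
    Finset.prod_le_one (fun j _ => by linarith [hσ1 (k+j)]) (fun j _ => by linarith [hσ0 (k+j)])
  have hit : ∀ N k n, a k (n+N) ≤ (∏ j ∈ Finset.range N, (1 - σ (k+j))) * a (k+N) n
      + (1 - ∏ j ∈ Finset.range N, (1 - σ (k+j))) * a 0 n := by
    intro N
    induction N with
    | zero => intro k n; simp
    | succ N ih =>
      intro k n
      have h1 := hrec k (n+N)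
      have h2 := ih (k+1) n
      rw [Finset.prod_range_succ']
      have h3 : a 0 (n+N) ≤ a 0 n := hanti (Nat.le_add_right n N)
      have h4 : ∏ j ∈ Finset.range N, (1 - σ (k + (j+1))) =
          ∏ j ∈ Finset.range N, (1 - σ (k + 1 + j)) :=
        Finset.prod_congr rfl fun j _ => by congr 2; omega
      have h5 : k + (N+1) = k + 1 + N := by omega
      rw [h4, h5, add_zero, ← add_assoc n]
      have h6 := mul_le_mul_of_nonneg_left h3 (hσ0 k)
      have h7 := mul_le_mul_of_nonneg_left h2 (sub_nonneg.2 (hσ1 k).le)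
      linarith
  have hαε : ∀ ε > 0, α ≤ ε := by
    intro ε hε
    obtain ⟨N, hN⟩ := hunif ε hε
    set P := ∏ j ∈ Finset.range N, (1 - σ (0+j)) with hP
    have hPpos : 0 < P := hpos N 0
    have h1 : ∀ n, α ≤ P * ε + (1 - P) * a 0 n := fun n => by
      have h2 := hit N 0 n
      have h3 := mul_le_mul_of_nonneg_left (hN n) hPpos.le
      rw [zero_add] at h2
      have := hαle (n+N)
      linarith
    have h2 : α ≤ P * ε + (1 - P) * α :=
      ge_of_tendsto' ((hlim.const_mul (1-P)).const_add (P*ε)) h1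
    have h3 : P * α ≤ P * ε := by linarith
    exact le_of_mul_le_mul_left h3 hPpos
  have : α = 0 := le_antisymm (le_of_forall_pos_le_add fun ε hε => by simpa using hαε ε hε) hα0
  rwa [this] at hlim

lemma aux_dini_summable (φ : ℝ → ℝ) (hm : MonotoneOn φ (Set.Ici 0)) (h0 : φ 0 = 0)
    (hi : IntervalIntegrable (fun t => φ t / t) volume 0 1) (r : ℝ) (hr0 : 0 < r) (hr1 : r < 1)
    (T : ℝ) (hT : 0 < T) : Summable (fun k : ℕ => φ (r^k * T)) := by
  have hnn : ∀ t, 0 ≤ t → 0 ≤ φ t := fun t ht => h0 ▸ hm (Set.mem_Ici.2 le_rfl) ht ht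
  obtain ⟨m, hmT⟩ : ∃ m : ℕ, r^m * T ≤ 1 := by
    have : Tendsto (fun m : ℕ => r^m * T) atTop (𝓝 (0 * T)) :=
      (tendsto_pow_atTop_nhds_zero_of_lt_one hr0.le hr1).mul_const T
    rw [zero_mul] at this
    exact ((this.eventually_le_const one_pos)).exists
  rw [← summable_nat_add_iff (m+1)]
  set S := r^m * T with hS
  have hS0 : 0 < S := by positivity
  have hx0 : ∀ k : ℕ, 0 < r^k * S := fun k => by positivity
  have hx1 : ∀ k : ℕ, r^k * S ≤ 1 := fun k => by
    have := pow_le_one₀ hr0.le hr1.le (n := k)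
    nlinarith
  have hint : ∀ x y, 0 ≤ x → x ≤ 1 → 0 ≤ y → y ≤ 1 →
      IntervalIntegrable (fun t => φ t / t) volume x y := fun x y a b c d =>
    hi.mono_set (by rw [Set.uIcc_of_le zero_le_one]; exact Set.uIcc_subset_Icc ⟨a,b⟩ ⟨c,d⟩)
  have hstep : ∀ k : ℕ, (1-r) * φ (r^(k+1) * S) ≤ ∫ t in (r^(k+1)*S)..(r^k*S), φ t / t := by
    intro k
    have hle : r^(k+1)*S ≤ r^k*S := by
      rw [pow_succ]; have := hx0 k; nlinarith
    have : (∫ t in (r^(k+1)*S)..(r^k*S), φ (r^(k+1)*S) / (r^k*S)) ≤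
        ∫ t in (r^(k+1)*S)..(r^k*S), φ t / t := by
      refine intervalIntegral.integral_mono_on hle (by simp)
        (hint _ _ (hx0 _).le (hx1 _) (hx0 _).le (hx1 _)) ?_
      intro t ht
      have ht0 : 0 < t := (hx0 _).trans_le ht.1
      have h1 : φ (r^(k+1)*S) ≤ φ t := hm (hx0 _).le ht0.le ht.1
      exact div_le_div₀ (hnn _ ht0.le) h1 ht0 ht.2
    refine le_trans (le_of_eq ?_) this
    rw [intervalIntegral.integral_const, smul_eq_mul]
    have := (hx0 k).ne'
    field_simp
    ring
  have hsum : ∀ n : ℕ, ∑ k ∈ Finset.range n, φ (r^(k+1) * S) ≤ (∫ t in (0:ℝ)..1, φ t / t) / (1-r) := by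
    intro n
    rw [le_div_iff₀ (by linarith), Finset.sum_mul]
    have e1 : ∑ k ∈ Finset.range n, ∫ t in (r^k*S)..(r^(k+1)*S), φ t / t
        = ∫ t in (r^0*S)..(r^n*S), φ t / t :=
      intervalIntegral.sum_integral_adjacent_intervals (a := fun k => r^k*S) (fun k _ =>
        hint _ _ (hx0 _).le (hx1 _) (hx0 _).le (hx1 _))
    have e2 : ∑ k ∈ Finset.range n, ∫ t in (r^(k+1)*S)..(r^k*S), φ t / t
        = ∫ t in (r^n*S)..(r^0*S), φ t / t := by
      rw [intervalIntegral.integral_symm, ← e1, ← Finset.sum_neg_distrib]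
      exact Finset.sum_congr rfl fun k _ => intervalIntegral.integral_symm _ _
    calc ∑ k ∈ Finset.range n, φ (r^(k+1) * S) * (1-r)
        ≤ ∑ k ∈ Finset.range n, ∫ t in (r^(k+1)*S)..(r^k*S), φ t / t :=
          Finset.sum_le_sum fun k _ => by rw [mul_comm]; exact hstep k
      _ = ∫ t in (r^n*S)..(r^0*S), φ t / t := e2
      _ ≤ ∫ t in (0:ℝ)..1, φ t / t := by
        refine intervalIntegral.integral_mono_interval (hx0 n).le ?_ (hx1 0) ?_ hi
        · have := pow_le_one₀ hr0.le hr1.le (n := n)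
          rw [pow_zero]; gcongr
        · filter_upwards [ae_restrict_mem measurableSet_Ioc] with t ht
          exact div_nonneg (hnn _ ht.1.le) ht.1.le
  have := summable_of_sum_range_le (fun k => hnn _ (hx0 (k+1)).le) hsum
  refine this.congr fun k => ?_
  rw [hS]; congr 1; ring

lemma aux_couple {L : ℕ} (p q u v : Fin L → ℝ) (s A O : ℝ) (hp : ∑ i, p i = 1) (hq : ∑ i, q i = 1)
    (hp0 : ∀ i, 0 ≤ p i) (hq0 : ∀ i, 0 ≤ q i) (hA : ∀ i, u i - v i ≤ A)
    (hO : ∀ i j, u i - v j ≤ O) (hAO : A ≤ O) (hs : 1 - ∑ i, min (p i) (q i) ≤ s) :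
    ∑ i, p i * u i - ∑ i, q i * v i ≤ (1 - s) * A + s * O := by
  have hne : Nonempty (Fin L) := by
    by_contra h
    rw [not_nonempty_iff] at h
    simp at hp
  obtain ⟨j, hj⟩ := Finite.exists_min v
  set m := fun i => min (p i) (q i) with hm
  have h1 : ∑ i, p i * u i - ∑ i, q i * v i ≤
      ∑ i, (m i * A + (p i - m i) * (v j + O) - (q i - m i) * v j) := by
    rw [← Finset.sum_sub_distrib]
    refine Finset.sum_le_sum fun i _ => ?_
    have a1 : 0 ≤ m i := le_min (hp0 i) (hq0 i)
    have a2 : 0 ≤ p i - m i := sub_nonneg.2 (min_le_left _ _)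
    have a3 : 0 ≤ q i - m i := sub_nonneg.2 (min_le_right _ _)
    have b1 := mul_le_mul_of_nonneg_left (hA i) a1
    have b2 := mul_le_mul_of_nonneg_left (show u i ≤ v j + O by linarith [hO i j]) a2
    have b3 := mul_le_mul_of_nonneg_left (hj i) a3
    nlinarith
  have h2 : ∑ i, (m i * A + (p i - m i) * (v j + O) - (q i - m i) * v j)
      = (∑ i, m i) * A + (1 - ∑ i, m i) * O := by
    rw [Finset.sum_sub_distrib, Finset.sum_add_distrib, ← Finset.sum_mul, ← Finset.sum_mul,
      ← Finset.sum_mul, Finset.sum_sub_distrib, Finset.sum_sub_distrib, hp, hq]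
    ring
  rw [h2] at h1
  have h3 : 1 - ∑ i, m i ≤ s := hs
  nlinarith

structure AuxIFS {X : Type*} [MetricSpace X] {L : ℕ} (p : Fin L → X → ℝ) (W : Fin L → X → X)
    (D : X → X → ℝ) (r δ : ℝ) (x0 : X) : Prop where
  dist_le : ∀ x y, dist x y ≤ D x y
  symm : ∀ x y, D x y = D y x
  tri : ∀ x y z, D x z ≤ D x y + D y z
  self : ∀ x, D x x = 0
  r0 : 0 < r
  r1 : r < 1
  contr : ∀ i x y, D (W i x) (W i y) ≤ r * D x y
  contW : ∀ i, Continuous (W i)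
  contD : Continuous (fun x => D x x0)
  psum : ∀ x, ∑ i, p i x = 1
  δ0 : 0 < δ
  plb : ∀ i x, δ ≤ p i x
  dini : ∀ i, DiniContinuous (p i)

def auxU {X : Type*} {L : ℕ} (p : Fin L → X → ℝ) (W : Fin L → X → X) (f : X → ℝ) (x : X) : ℝ :=
  ∑ i, p i x * f (W i x)

lemma aux_dini_cont {X : Type*} [MetricSpace X] (p : X → ℝ) (hp : DiniContinuous p) :
    Continuous p := by
  obtain ⟨φ, hm, h0, hi, hφ⟩ := hp
  have hs := (aux_dini_summable φ hm h0 hi (1/2) (by norm_num) (by norm_num) 1 one_pos)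
  have ht := hs.tendsto_atTop_zero
  rw [Metric.continuous_iff]
  intro b ε hε
  obtain ⟨k, hk⟩ := (ht.eventually_lt_const hε).exists
  refine ⟨(1/2)^k * 1, by positivity, fun a ha => ?_⟩
  rw [Real.dist_eq]
  refine (hφ a b).trans_lt (lt_of_le_of_lt (hm dist_nonneg (Set.mem_Ici.2 ?_) ha.le) hk)
  positivity

namespace AuxIFS

variable {X : Type*} [MetricSpace X] {L : ℕ} {p : Fin L → X → ℝ} {W : Fin L → X → X}
    {D : X → X → ℝ} {r δ : ℝ} {x0 : X}

lemma p0 (h : AuxIFS p W D r δ x0) (i : Fin L) (x : X) : 0 ≤ p i x := h.δ0.le.trans (h.plb i x)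

lemma D0 (h : AuxIFS p W D r δ x0) (x y : X) : 0 ≤ D x y := dist_nonneg.trans (h.dist_le x y)

lemma contp (h : AuxIFS p W D r δ x0) (i : Fin L) : Continuous (p i) := aux_dini_cont _ (h.dini i)

lemma exR (h : AuxIFS p W D r δ x0) :
    ∃ R : ℝ, 0 ≤ R ∧ ∀ i x, D (W i x) x0 - R ≤ r * (D x x0 - R) := by
  set b := ∑ i, D (W i x0) x0 with hb
  have h1 : 0 < 1 - r := by linarith [h.r1]
  have hb0 : 0 ≤ b := Finset.sum_nonneg fun i _ => h.D0 _ _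
  refine ⟨b / (1-r), div_nonneg hb0 h1.le, fun i x => ?_⟩
  have h2 : D (W i x0) x0 ≤ b :=
    Finset.single_le_sum (f := fun i => D (W i x0) x0) (fun i _ => h.D0 _ _) (Finset.mem_univ i)
  have h3 := h.tri (W i x) (W i x0) x0
  have h4 := h.contr i x x0
  have h5 : b = (1-r) * (b/(1-r)) := by field_simp
  linarith

lemma U_bound (h : AuxIFS p W D r δ x0) (f : X → ℝ) (c ε : ℝ) (x : X)
    (hf : ∀ i, |f (W i x) - c| ≤ ε) : |auxU p W f x - c| ≤ ε := by
  have e : auxU p W f x - c = ∑ i, p i x * (f (W i x) - c) := by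
    simp only [auxU, mul_sub, Finset.sum_sub_distrib, ← Finset.sum_mul, h.psum, one_mul]
  rw [e]
  refine (Finset.abs_sum_le_sum_abs _ _).trans ?_
  calc ∑ i, |p i x * (f (W i x) - c)| ≤ ∑ i, p i x * ε := Finset.sum_le_sum fun i _ => by
        rw [abs_mul, abs_of_nonneg (h.p0 i x)]
        exact mul_le_mul_of_nonneg_left (hf i) (h.p0 i x)
    _ = ε := by rw [← Finset.sum_mul, h.psum, one_mul]

lemma U_cont (h : AuxIFS p W D r δ x0) (f : X → ℝ) (hf : Continuous f) :
    Continuous (auxU p W f) :=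
  continuous_finsetSum _ fun i _ => (h.contp i).mul (hf.comp (h.contW i))

lemma Un_cont (h : AuxIFS p W D r δ x0) (f : X → ℝ) (hf : Continuous f) (n : ℕ) :
    Continuous ((auxU p W)^[n] f) := by
  induction n with
  | zero => exact hf
  | succ n ih => rw [Function.iterate_succ_apply']; exact h.U_cont _ ih

lemma Un_bdd (h : AuxIFS p W D r δ x0) (f : X → ℝ) (M : ℝ) (hf : ∀ x, |f x| ≤ M) (n : ℕ) :
    ∀ x, |(auxU p W)^[n] f x| ≤ M := by
  induction n with
  | zero => exact hf
  | succ n ih =>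
    intro x
    rw [Function.iterate_succ_apply']
    have := h.U_bound ((auxU p W)^[n] f) 0 M x (fun i => by rw [sub_zero]; exact ih _)
    rwa [sub_zero] at this

lemma Un_enter (h : AuxIFS p W D r δ x0) (R : ℝ)
    (hR : ∀ i x, D (W i x) x0 - R ≤ r * (D x x0 - R)) (f : X → ℝ) (c ε : ℝ)
    (hf : ∀ x, D x x0 ≤ R + 1 → |f x - c| ≤ ε) (m : ℕ) :
    ∀ x, r^m * (D x x0 - R) ≤ 1 → |(auxU p W)^[m] f x - c| ≤ ε := by
  induction m with
  | zero => intro x hx; exact hf x (by rw [pow_zero, one_mul] at hx; linarith)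
  | succ m ih =>
    intro x hx
    rw [Function.iterate_succ_apply']
    refine h.U_bound _ c ε x fun i => ih _ ?_
    have := mul_le_mul_of_nonneg_left (hR i x) (pow_nonneg h.r0.le m)
    rw [pow_succ] at hx
    linarith

lemma osc (h : AuxIFS p W D r δ x0) [ProperSpace X] (R : ℝ) (hR0 : 0 ≤ R)
    (hR : ∀ i x, D (W i x) x0 - R ≤ r * (D x x0 - R)) (f : X → ℝ) (hfc : Continuous f) (M : ℝ)
    (hM : ∀ x, |f x| ≤ M) :
    ∃ e : ℕ → ℝ, Tendsto e atTop (𝓝 0) ∧ ∀ n x y, D x x0 ≤ R + 1 → D y x0 ≤ R + 1 →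
      |(auxU p W)^[n] f x - (auxU p W)^[n] f y| ≤ e n := by
  set T := 2 * (R + 1) with hT
  have hT0 : 0 < T := by positivity
  have hr0 := h.r0
  have hr1 := h.r1
  set S : ℕ → ℕ → Set ℝ := fun k n => {d | ∃ x y, D x x0 ≤ R + 1 ∧ D y x0 ≤ R + 1 ∧
    D x y ≤ r^k * T ∧ d = |(auxU p W)^[n] f x - (auxU p W)^[n] f y|} with hS
  set a : ℕ → ℕ → ℝ := fun k n => sSup (S k n) with ha
  have hbd : ∀ k n, BddAbove (S k n) := fun k n => ⟨M + M, by
    rintro _ ⟨x, y, -, -, -, rfl⟩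
    exact (abs_sub _ _).trans (add_le_add (h.Un_bdd f M hM n x) (h.Un_bdd f M hM n y))⟩
  have hle : ∀ k n x y, D x x0 ≤ R + 1 → D y x0 ≤ R + 1 → D x y ≤ r^k * T →
      |(auxU p W)^[n] f x - (auxU p W)^[n] f y| ≤ a k n := fun k n x y h1 h2 h3 =>
    le_csSup (hbd k n) ⟨x, y, h1, h2, h3, rfl⟩
  have hsup : ∀ k n c, 0 ≤ c → (∀ x y, D x x0 ≤ R + 1 → D y x0 ≤ R + 1 → D x y ≤ r^k * T →
      |(auxU p W)^[n] f x - (auxU p W)^[n] f y| ≤ c) → a k n ≤ c := by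
    intro k n c hc hh
    refine Real.sSup_le ?_ hc
    rintro _ ⟨x, y, h1, h2, h3, rfl⟩
    exact hh x y h1 h2 h3
  have ha0 : ∀ k n, 0 ≤ a k n := fun k n => Real.sSup_nonneg (by
    rintro _ ⟨x, y, -, -, -, rfl⟩; exact abs_nonneg _)
  have hDT : ∀ x y, D x x0 ≤ R + 1 → D y x0 ≤ R + 1 → D x y ≤ r^0 * T := by
    intro x y h1 h2
    have := h.tri x x0 y
    rw [h.symm x0 y] at this
    rw [pow_zero]
    linarith
  have hB : ∀ i x, D x x0 ≤ R + 1 → D (W i x) x0 ≤ R + 1 := fun i x hx => by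
    have := hR i x
    nlinarith
  have hφ := h.dini
  choose φ hφm hφ0 hφi hφ using hφ
  set ψ : ℝ → ℝ := fun t => ∑ i, φ i t with hψ
  set σ : ℕ → ℝ := fun k => min (1 - δ) (ψ (r^k * T)) with hσ
  have hrT : ∀ k : ℕ, 0 ≤ r^k * T := fun k => by positivity
  have hφnn : ∀ i t, 0 ≤ t → 0 ≤ φ i t := fun i t ht => by
    have := hφm i (Set.mem_Ici.2 le_rfl) ht ht
    rwa [hφ0] at this
  have hne : Nonempty (Fin L) := by
    by_contra hh
    rw [not_nonempty_iff] at hh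
    have := h.psum x0
    simp at this
  have hδ1 : δ ≤ 1 := by
    obtain ⟨i⟩ := hne
    refine (h.plb i x0).trans ?_
    rw [← h.psum x0]
    exact Finset.single_le_sum (f := fun i => p i x0) (fun i _ => h.p0 _ _) (Finset.mem_univ i)
  have hψ0 : ∀ t, 0 ≤ t → 0 ≤ ψ t := fun t ht => Finset.sum_nonneg fun i _ => hφnn i t ht
  have hσ0 : ∀ k, 0 ≤ σ k := fun k => le_min (by linarith) (hψ0 _ (hrT k))
  have hσ1 : ∀ k, σ k < 1 := fun k => (min_le_left _ _).trans_lt (by linarith [h.δ0])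
  have hσs : Summable σ := by
    refine Summable.of_nonneg_of_le hσ0 (fun k => min_le_right _ _) ?_
    exact summable_sum fun i _ => aux_dini_summable (φ i) (hφm i) (hφ0 i) (hφi i) r hr0 hr1 T hT0
  have hs : ∀ k x y, D x y ≤ r^k * T → 1 - ∑ i, min (p i x) (p i y) ≤ σ k := by
    intro k x y hxy
    refine le_min ?_ ?_
    · obtain ⟨i⟩ := hne
      have h1 : min (p i x) (p i y) ≤ ∑ i, min (p i x) (p i y) :=
        Finset.single_le_sum (f := fun i => min (p i x) (p i y))
          (fun i _ => le_min (h.p0 _ _) (h.p0 _ _)) (Finset.mem_univ i)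
      have h2 : δ ≤ min (p i x) (p i y) := le_min (h.plb _ _) (h.plb _ _)
      linarith
    · rw [← h.psum x, ← Finset.sum_sub_distrib]
      refine Finset.sum_le_sum fun i _ => ?_
      have h1 : p i x - min (p i x) (p i y) ≤ |p i x - p i y| := by
        rcases le_total (p i x) (p i y) with h3 | h3
        · rw [min_eq_left h3, sub_self]; exact abs_nonneg _
        · rw [min_eq_right h3]; exact le_abs_self _
      exact h1.trans ((hφ i x y).trans (hφm i dist_nonneg (hrT k) ((h.dist_le x y).trans hxy)))
  have hk : ∀ k n, a k n ≤ a 0 n := fun k n => hsup k n _ (ha0 0 n) fun x y h1 h2 _ =>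
    hle 0 n x y h1 h2 (hDT x y h1 h2)
  have hrec : ∀ k n, a k (n+1) ≤ (1 - σ k) * a (k+1) n + σ k * a 0 n := by
    intro k n
    have hnn : 0 ≤ (1 - σ k) * a (k+1) n + σ k * a 0 n :=
      add_nonneg (mul_nonneg (by linarith [hσ1 k]) (ha0 _ _)) (mul_nonneg (hσ0 k) (ha0 _ _))
    have one : ∀ x y, D x x0 ≤ R + 1 → D y x0 ≤ R + 1 → D x y ≤ r^k * T →
        (auxU p W)^[n+1] f x - (auxU p W)^[n+1] f y ≤ (1 - σ k) * a (k+1) n + σ k * a 0 n := by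
      intro x y h1 h2 h3
      rw [Function.iterate_succ_apply']
      refine aux_couple (fun i => p i x) (fun i => p i y) (fun i => (auxU p W)^[n] f (W i x))
        (fun i => (auxU p W)^[n] f (W i y)) (σ k) (a (k+1) n) (a 0 n) (h.psum x) (h.psum y)
        (fun i => h.p0 i x) (fun i => h.p0 i y) ?_ ?_ (hk _ _) (hs k x y h3)
      · intro i
        refine (le_abs_self _).trans (hle (k+1) n _ _ (hB i x h1) (hB i y h2) ?_)
        refine (h.contr i x y).trans ?_
        rw [pow_succ', mul_assoc]
        exact mul_le_mul_of_nonneg_left h3 hr0.le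
      · intro i j
        exact (le_abs_self _).trans (hle 0 n _ _ (hB i x h1) (hB j y h2)
          (hDT _ _ (hB i x h1) (hB j y h2)))
    refine hsup k (n+1) _ hnn fun x y h1 h2 h3 => ?_
    rw [abs_le]
    have o1 := one x y h1 h2 h3
    have o2 := one y x h2 h1 (by rw [h.symm]; exact h3)
    constructor <;> linarith
  have hz : Tendsto (fun k => a k 0) atTop (𝓝 0) := by
    have huc : UniformContinuousOn f (Metric.closedBall x0 (R+1)) :=
      (isCompact_closedBall x0 (R+1)).uniformContinuousOn_of_continuous hfc.continuousOn
    rw [Metric.uniformContinuousOn_iff] at huc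
    rw [Metric.tendsto_atTop]
    intro ε hε
    obtain ⟨η, hη, hh⟩ := huc (ε/2) (by linarith)
    have ht : Tendsto (fun m : ℕ => r^m * T) atTop (𝓝 (0 * T)) :=
      (tendsto_pow_atTop_nhds_zero_of_lt_one hr0.le hr1).mul_const T
    rw [zero_mul] at ht
    obtain ⟨N, hN⟩ := eventually_atTop.1 (ht.eventually_lt_const hη)
    refine ⟨N, fun k hk => ?_⟩
    rw [Real.dist_eq, sub_zero, abs_of_nonneg (ha0 k 0)]
    refine lt_of_le_of_lt (hsup k 0 (ε/2) (by linarith) fun x y h1 h2 h3 => ?_) (by linarith : ε/2 < ε)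
    have := hh x (Metric.mem_closedBall.2 ((h.dist_le _ _).trans h1)) y
      (Metric.mem_closedBall.2 ((h.dist_le _ _).trans h2))
      (((h.dist_le _ _).trans h3).trans_lt (hN k hk))
    rw [Real.dist_eq] at this
    exact this.le
  exact ⟨fun n => a 0 n, aux_seq a σ ha0 hk hσ0 hσ1 hσs hrec hz, fun n x y h1 h2 =>
    hle 0 n x y h1 h2 (hDT x y h1 h2)⟩

lemma conv (h : AuxIFS p W D r δ x0) [ProperSpace X] (f : X → ℝ) (hfc : Continuous f) (M : ℝ)
    (hM : ∀ x, |f x| ≤ M) :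
    ∃ c : ℝ, ∀ x, Tendsto (fun n => (auxU p W)^[n] f x) atTop (𝓝 c) := by
  obtain ⟨R, hR0, hR⟩ := h.exR
  obtain ⟨e, he, hosc⟩ := h.osc R hR0 hR f hfc M hM
  have hx0 : D x0 x0 ≤ R + 1 := by rw [h.self]; linarith
  have key : ∀ n m x, r^m * (D x x0 - R) ≤ 1 →
      |(auxU p W)^[m+n] f x - (auxU p W)^[n] f x0| ≤ e n := by
    intro n m x hx
    rw [Function.iterate_add_apply]
    exact h.Un_enter R hR _ _ _ (fun y hy => hosc n y x0 hy hx0) m x hx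
  have hcau : CauchySeq (fun n => (auxU p W)^[n] f x0) := by
    rw [Metric.cauchySeq_iff']
    intro ε hε
    obtain ⟨N, hN⟩ := (he.eventually_lt_const hε).exists
    refine ⟨N, fun n hn => ?_⟩
    obtain ⟨m, rfl⟩ := Nat.exists_eq_add_of_le' hn
    rw [Real.dist_eq]
    refine (key N m x0 ?_).trans_lt hN
    rw [h.self]
    have := mul_nonneg (pow_nonneg h.r0.le m) hR0
    linarith
  obtain ⟨c, hc⟩ := cauchySeq_tendsto_of_complete hcau
  refine ⟨c, fun x => ?_⟩
  obtain ⟨m, hm⟩ : ∃ m : ℕ, r^m * (D x x0 - R) ≤ 1 := by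
    have : Tendsto (fun m : ℕ => r^m * (D x x0 - R)) atTop (𝓝 (0 * (D x x0 - R))) :=
      (tendsto_pow_atTop_nhds_zero_of_lt_one h.r0.le h.r1).mul_const _
    rw [zero_mul] at this
    exact ((this.eventually_le_const one_pos)).exists
  rw [← tendsto_add_atTop_iff_nat m]
  have h1 : Tendsto (fun n => (auxU p W)^[n+m] f x - (auxU p W)^[n] f x0) atTop (𝓝 0) :=
    squeeze_zero_norm (fun n => by
      rw [Real.norm_eq_abs, add_comm]; exact key n m x hm) he
  have := h1.add hc
  simpa using this

variable [MeasurableSpace X] [BorelSpace X]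

lemma meas_ker (h : AuxIFS p W D r δ x0) : Measurable (IFSKernel p W) := by
  refine Measure.measurable_of_measurable_coe _ fun s hs => ?_
  simp only [IFSKernel, Measure.coe_finsetSum, Finset.sum_apply, Measure.smul_apply, smul_eq_mul,
    Measure.dirac_apply' _ hs]
  refine Finset.measurable_sum _ fun i _ => ?_
  exact ((h.contp i).measurable.ennreal_ofReal).mul
    ((measurable_one.indicator hs).comp (h.contW i).measurable)

lemma prob_ker (h : AuxIFS p W D r δ x0) (x : X) : IsProbabilityMeasure (IFSKernel p W x) := by
  constructor
  simp only [IFSKernel, Measure.coe_finsetSum, Finset.sum_apply, Measure.smul_apply, smul_eq_mul,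
    measure_univ, mul_one]
  rw [← ENNReal.ofReal_sum_of_nonneg (fun i _ => h.p0 i x), h.psum, ENNReal.ofReal_one]

lemma int_ker (h : AuxIFS p W D r δ x0) (f : X → ℝ) (hf : Continuous f) (x : X) :
    ∫ y, f y ∂(IFSKernel p W x) = auxU p W f x := by
  have hi : ∀ i, Integrable f (ENNReal.ofReal (p i x) • Measure.dirac (W i x)) := fun i =>
    (integrable_dirac' hf.stronglyMeasurable (by simp)).smul_measure ENNReal.ofReal_ne_top
  rw [IFSKernel, integral_finsetSum_measure (fun i _ => hi i), auxU]
  refine Finset.sum_congr rfl fun i _ => ?_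
  rw [integral_smul_measure, integral_dirac, ENNReal.toReal_ofReal (h.p0 i x), smul_eq_mul]

lemma prob_bind (h : AuxIFS p W D r δ x0) (ν : Measure X) [IsProbabilityMeasure ν] :
    IsProbabilityMeasure (ν.bind (IFSKernel p W)) :=
  isProbabilityMeasure_bind h.meas_ker.aemeasurable (ae_of_all _ h.prob_ker)

lemma int_bind (h : AuxIFS p W D r δ x0) (ν : Measure X) [IsProbabilityMeasure ν]
    (f : X → ℝ) (hf : Continuous f) (M : ℝ) (hM : ∀ x, |f x| ≤ M) :
    ∫ y, f y ∂(ν.bind (IFSKernel p W)) = ∫ x, auxU p W f x ∂ν := by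
  have := h.prob_bind ν
  have hi : Integrable f (ν.bind (IFSKernel p W)) :=
    Integrable.of_bound hf.aestronglyMeasurable M (ae_of_all _ hM)
  let K : ProbabilityTheory.Kernel X X := ⟨IFSKernel p W, h.meas_ker⟩
  have := ProbabilityTheory.Kernel.integral_comp (κ := ProbabilityTheory.Kernel.const Unit ν) (η := K) (a := ()) (f := f) (by
      rw [ProbabilityTheory.Kernel.comp_apply]; exact hi)
  rw [ProbabilityTheory.Kernel.comp_apply] at this
  refine Eq.trans this ?_
  exact integral_congr_ae (ae_of_all _ fun x => h.int_ker f hf x)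

lemma int_iter (h : AuxIFS p W D r δ x0) (ν : Measure X) [IsProbabilityMeasure ν]
    (f : X → ℝ) (hf : Continuous f) (M : ℝ) (hM : ∀ x, |f x| ≤ M) (n : ℕ) :
    IsProbabilityMeasure ((fun m : Measure X => m.bind (IFSKernel p W))^[n] ν) ∧
    ∫ y, f y ∂((fun m : Measure X => m.bind (IFSKernel p W))^[n] ν) =
      ∫ x, (auxU p W)^[n] f x ∂ν := by
  induction n generalizing f with
  | zero => exact ⟨‹_›, rfl⟩
  | succ n ih =>
    have hp := (ih f hf hM).1
    rw [Function.iterate_succ_apply', Function.iterate_succ_apply]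
    refine ⟨h.prob_bind _, ?_⟩
    rw [h.int_bind _ f hf M hM]
    exact (ih _ (h.U_cont f hf) (h.Un_bdd f M hM 1)).2

lemma int_lim (h : AuxIFS p W D r δ x0) (ν : Measure X) [IsProbabilityMeasure ν]
    (f : X → ℝ) (hf : Continuous f) (M : ℝ) (hM : ∀ x, |f x| ≤ M) (c : ℝ)
    (hc : ∀ x, Tendsto (fun n => (auxU p W)^[n] f x) atTop (𝓝 c)) :
    Tendsto (fun k => ∫ x, f x ∂((fun m : Measure X => m.bind (IFSKernel p W))^[k] ν))
        atTop (𝓝 c) := by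
  simp only [fun k => (h.int_iter ν f hf M hM k).2]
  have := tendsto_integral_of_dominated_convergence (μ := ν) (F := fun n => (auxU p W)^[n] f)
    (f := fun _ => c) (fun _ => M) (fun n => (h.Un_cont f hf n).aestronglyMeasurable)
    (integrable_const M) (fun n => ae_of_all _ (h.Un_bdd f M hM n)) (ae_of_all _ hc)
  simpa using this

lemma exists_meas (h : AuxIFS p W D r δ x0) [ProperSpace X] :
    ∃ μ : Measure X, IsProbabilityMeasure μ ∧ ∀ f : BoundedContinuousFunction X ℝ,
      ∀ c, (∀ x, Tendsto (fun n => (auxU p W)^[n] f x) atTop (𝓝 c)) → ∫ x, f x ∂μ = c := by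
  obtain ⟨R, hR0, hR⟩ := h.exR
  set B : Set X := {x | D x x0 ≤ R + 1} with hB
  have hBc : IsClosed B := isClosed_le h.contD continuous_const
  have hBK : IsCompact B := (isCompact_closedBall x0 (R+1)).of_isClosed_subset hBc
    fun x hx => Metric.mem_closedBall.2 ((h.dist_le x x0).trans hx)
  set m : ℕ → Measure X := fun n => (fun m : Measure X => m.bind (IFSKernel p W))^[n]
    (Measure.dirac x0) with hm
  have hprob : ∀ n, IsProbabilityMeasure (m n) := fun n =>
    (h.int_iter (Measure.dirac x0) (fun _ => 0) continuous_const 0 (by simp) n).1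
  have hBW : ∀ i x, x ∈ B → W i x ∈ B := fun i x hx => by
    have h1 := hR i x
    have h2 := h.r0
    have h3 := h.r1
    simp only [hB, Set.mem_ofPred_eq] at hx ⊢
    nlinarith
  have hsupp : ∀ n, m n Bᶜ = 0 := by
    intro n
    induction n with
    | zero =>
      simp only [hm, Function.iterate_zero, id]
      rw [Measure.dirac_apply' _ hBc.measurableSet.compl]
      have : x0 ∈ B := by simp only [hB, Set.mem_ofPred_eq, h.self]; linarith
      simp [this]
    | succ n ih =>
      simp only [hm, Function.iterate_succ_apply']
      rw [Measure.bind_apply hBc.measurableSet.compl h.meas_ker.aemeasurable]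
      rw [lintegral_eq_zero_iff' (Measure.measurable_measure.1 h.meas_ker _
        hBc.measurableSet.compl).aemeasurable]
      have : ∀ᵐ x ∂(m n), x ∈ B := by rw [ae_iff]; exact ih
      filter_upwards [this] with x hx
      simp only [IFSKernel, Measure.coe_finsetSum, Finset.sum_apply, Measure.smul_apply, smul_eq_mul,
        Measure.dirac_apply' _ hBc.measurableSet.compl]
      refine Finset.sum_eq_zero fun i _ => ?_
      simp [hBW i x hx]
  let P : ℕ → ProbabilityMeasure X := fun n => ⟨m n, hprob n⟩
  have hcomp : IsCompact (closure (Set.range P)) := by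
    refine isCompact_closure_of_isTightMeasureSet ?_
    rw [isTightMeasureSet_iff_exists_isCompact_measure_compl_le]
    intro ε hε
    refine ⟨B, hBK, ?_⟩
    rintro _ ⟨_, ⟨n, rfl⟩, rfl⟩
    exact (hsupp n).le.trans zero_le
  obtain ⟨μ, -, hμ⟩ := hcomp.ultrafilter_le_nhds ((Filter.hyperfilter ℕ).map P) (by
    rw [Filter.le_principal_iff]
    exact Filter.mem_map.2 (Filter.univ_mem' fun n => subset_closure ⟨n, rfl⟩))
  refine ⟨μ, inferInstance, fun f c hc => ?_⟩
  have t1 : Tendsto P (Filter.hyperfilter ℕ) (𝓝 μ) := hμ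
  have t2 := (ProbabilityMeasure.tendsto_iff_forall_integral_tendsto.1 t1) f
  have t3 := (h.int_lim (Measure.dirac x0) f f.continuous ‖f‖ (fun x => f.norm_coe_le_norm x)
    c hc).mono_left Nat.hyperfilter_le_atTop
  exact tendsto_nhds_unique t2 t3

theorem final (h : AuxIFS p W D r δ x0) [ProperSpace X] :
    ∃ μstar : Measure X, (IsProbabilityMeasure μstar ∧ Invariant (IFSKernel p W) μstar) ∧
      (∀ μ : Measure X, IsProbabilityMeasure μ → Invariant (IFSKernel p W) μ → μ = μstar) ∧
      Attractive (IFSKernel p W) μstar := by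
  obtain ⟨μ, hμ, hint⟩ := h.exists_meas
  have hfb : ∀ (f : BoundedContinuousFunction X ℝ) x, |f x| ≤ ‖f‖ := fun f x => f.norm_coe_le_norm x
  have hatt : Attractive (IFSKernel p W) μ := by
    intro ν hν f
    obtain ⟨c, hc⟩ := h.conv f f.continuous ‖f‖ (hfb f)
    rw [hint f c hc]
    exact h.int_lim ν f f.continuous ‖f‖ (hfb f) c hc
  refine ⟨μ, ⟨hμ, ?_⟩, ?_, hatt⟩
  · have := h.prob_bind μ
    refine ext_of_forall_integral_eq_of_IsFiniteMeasure fun f => ?_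
    obtain ⟨c, hc⟩ := h.conv f f.continuous ‖f‖ (hfb f)
    rw [h.int_bind μ f f.continuous ‖f‖ (hfb f), hint f c hc]
    refine hint (BoundedContinuousFunction.ofNormedAddCommGroup (auxU p W f)
      (h.U_cont f f.continuous) ‖f‖ (h.Un_bdd f ‖f‖ (hfb f) 1)) c fun x => ?_
    have := (tendsto_add_atTop_iff_nat 1).2 (hc x)
    simp only [Function.iterate_succ_apply] at this
    exact this
  · intro ν hν hinv
    refine ext_of_forall_integral_eq_of_IsFiniteMeasure fun f => ?_
    have hfix : ∀ k, (fun m : Measure X => m.bind (IFSKernel p W))^[k] ν = ν := fun k =>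
      Function.iterate_fixed (f := fun m : Measure X => m.bind (IFSKernel p W)) hinv k
    have := hatt ν hν f
    simp only [hfix] at this
    exact tendsto_nhds_unique tendsto_const_nhds this

end AuxIFS

section
attribute [local instance] Matrix.linftyOpNormedAddCommGroup Matrix.linftyOpNormedRing Matrix.linftyOpNormedAlgebra

lemma aux_pow_zero {n : ℕ} [NeZero n] (a : Matrix (Fin n) (Fin n) ℂ)
    (ha : ∀ z ∈ spectrum ℂ a, ‖z‖ < 1) : Tendsto (fun k : ℕ => a ^ k) atTop (𝓝 0) := by
  have : CompleteSpace (Matrix (Fin n) (Fin n) ℂ) := FiniteDimensional.complete ℂ _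
  have h1 : spectralRadius ℂ a < (1 : NNReal) :=
    spectrum.spectralRadius_lt_of_forall_lt a (fun z hz => by exact_mod_cast ha z hz)
  obtain ⟨c, hc1, hc2⟩ := ENNReal.lt_iff_exists_nnreal_btwn.1 h1
  have h2 := (spectrum.pow_nnnorm_pow_one_div_tendsto_nhds_spectralRadius a).eventually_lt_const hc1
  have hc : c < 1 := by exact_mod_cast hc2
  refine squeeze_zero_norm' (a := fun k : ℕ => (c:ℝ)^k) ?_
    (tendsto_pow_atTop_nhds_zero_of_lt_one c.2 (by exact_mod_cast hc))
  filter_upwards [h2, eventually_gt_atTop 0] with k hk hk0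
  have h3 : (‖a^k‖₊ : ENNReal) ≤ (c : ENNReal)^k := by
    have := ENNReal.rpow_le_rpow hk.le (Nat.cast_nonneg k : (0:ℝ) ≤ k)
    rw [← ENNReal.rpow_mul, one_div, inv_mul_cancel₀ (by positivity), ENNReal.rpow_one,
      ENNReal.rpow_natCast] at this
    exact this
  have h4 : ‖a^k‖₊ ≤ c^k := by exact_mod_cast h3
  exact_mod_cast h4

end

lemma aux_schur {n : ℕ} (A : Matrix (Fin n) (Fin n) ℝ) (hA : IsSchur A) :
    ∃ m : ℕ, 0 < m ∧ ∀ z, ‖((Matrix.toEuclideanLin A)^m) z‖ ≤ 1/2 * ‖z‖ := by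
  rcases Nat.eq_zero_or_pos n with rfl | hn
  · refine ⟨1, one_pos, fun z => ?_⟩
    rw [Subsingleton.elim z 0]; simp
  have : NeZero n := ⟨hn.ne'⟩
  have h1 := aux_pow_zero _ hA
  have h2 : Tendsto (fun k : ℕ => A^k) atTop (𝓝 0) := by
    have hc : Continuous (fun M : Matrix (Fin n) (Fin n) ℂ => M.map Complex.re) :=
      continuous_id.matrix_map Complex.continuous_re
    have := (hc.tendsto 0).comp h1
    have e : (0 : Matrix (Fin n) (Fin n) ℂ).map Complex.re = 0 := by ext; simp
    rw [e] at this
    refine this.congr fun k => ?_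
    have e2 : (A.map (fun x : ℝ => (x:ℂ)))^k = (A^k).map (fun x : ℝ => (x:ℂ)) :=
      (Matrix.map_pow A Complex.ofRealHom k).symm
    simp only [Function.comp, e2]
    ext i j; simp
  let Φ := Matrix.toEuclideanCLM (n := Fin n) (𝕜 := ℝ)
  have hΦ : Continuous Φ :=
    LinearMap.continuous_of_finiteDimensional Φ.toAlgEquiv.toLinearMap
  have h3 := (hΦ.tendsto 0).comp h2
  rw [map_zero] at h3
  have h4 := h3.norm
  rw [norm_zero] at h4
  obtain ⟨m, hm, hm0⟩ := ((h4.eventually_le_const (by norm_num : (0:ℝ) < 1/2)).and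
    (eventually_gt_atTop 0)).exists
  refine ⟨m, hm0, fun z => ?_⟩
  have h5 := (Φ (A^m)).le_of_opNorm_le hm z
  have e : ((Matrix.toEuclideanLin A)^m) z = Φ (A^m) z := by
    rw [map_pow]
    have e0 : ∀ y, Matrix.toEuclideanLin A y = Φ A y := fun y => rfl
    clear h5 hm hm0
    induction m generalizing z with
    | zero => rfl
    | succ m ih => rw [pow_succ, pow_succ, Module.End.mul_apply, ContinuousLinearMap.mul_apply, ih, e0]
  rw [e]; exact h5

lemma aux_norm {n : ℕ} (A : Matrix (Fin n) (Fin n) ℝ) (hA : IsSchur A) :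
    ∃ (N : EuclideanSpace ℝ (Fin n) → ℝ) (ρ C : ℝ), 0 < ρ ∧ ρ < 1 ∧ 0 ≤ C ∧
      (∀ z, ‖z‖ ≤ N z) ∧ (∀ z, N z ≤ C * ‖z‖) ∧ (∀ z, N (-z) = N z) ∧
      (∀ y z, N (y + z) ≤ N y + N z) ∧ (∀ z, N (Matrix.toEuclideanLin A z) ≤ ρ * N z) ∧
      Continuous N := by
  obtain ⟨m, hm, hA⟩ := aux_schur A hA
  set T := Matrix.toEuclideanLin A with hT
  obtain ⟨ρ, hρ0, hρ1, hρ⟩ : ∃ ρ : ℝ, 0 < ρ ∧ ρ < 1 ∧ 1/2 ≤ ρ^m := by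
    have hm' : (1:ℝ) ≤ m := by exact_mod_cast hm
    have h1 : (1:ℝ)/(2*m) ≤ 1/2 := by
      rw [div_le_div_iff₀ (by positivity) (by positivity)]; linarith
    have h0 : (0:ℝ) < 1/(2*m) := by positivity
    refine ⟨1 - 1/(2*m), by linarith, by linarith, ?_⟩
    have h2 := one_add_mul_le_pow (a := -(1/(2*m) : ℝ)) (by linarith) m
    have h3 : (1:ℝ) + m * (-(1/(2*m))) = 1/2 := by field_simp; norm_num
    rw [h3] at h2
    rwa [sub_eq_add_neg]
  set N : EuclideanSpace ℝ (Fin n) → ℝ := fun z => ∑ k ∈ Finset.range m, ‖(T^k) z‖ * (ρ⁻¹)^k with hN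
  have hρi : 0 < ρ⁻¹ := inv_pos.2 hρ0
  have hcont : ∀ k : ℕ, Continuous (fun z => (T^k) z) := fun k => LinearMap.continuous_of_finiteDimensional _
  refine ⟨N, ρ, ∑ k ∈ Finset.range m, ‖LinearMap.toContinuousLinearMap (T^k)‖ * (ρ⁻¹)^k,
    hρ0, hρ1, Finset.sum_nonneg fun k _ => by positivity, ?_, ?_, ?_, ?_, ?_, ?_⟩
  · intro z
    have := Finset.single_le_sum (f := fun k => ‖(T^k) z‖ * (ρ⁻¹)^k) (fun k _ => by positivity)
      (Finset.mem_range.2 hm)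
    simpa [hN] using this
  · intro z
    rw [Finset.sum_mul]
    refine Finset.sum_le_sum fun k _ => ?_
    have := (LinearMap.toContinuousLinearMap (T^k)).le_opNorm z
    rw [LinearMap.coe_toContinuousLinearMap'] at this
    have h2 : 0 ≤ (ρ⁻¹)^k := by positivity
    nlinarith
  · intro z; simp [hN]
  · intro y z
    simp only [hN]
    rw [← Finset.sum_add_distrib]
    refine Finset.sum_le_sum fun k _ => ?_
    rw [map_add, ← add_mul]
    exact mul_le_mul_of_nonneg_right (norm_add_le _ _) (by positivity)
  · intro z
    have e1 : N (T z) = ρ * ∑ k ∈ Finset.range m, ‖(T^(k+1)) z‖ * (ρ⁻¹)^(k+1) := by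
      simp only [hN]
      rw [Finset.mul_sum]
      refine Finset.sum_congr rfl fun k _ => ?_
      rw [pow_succ T, Module.End.mul_apply, pow_succ]
      field_simp
    rw [e1]
    refine mul_le_mul_of_nonneg_left ?_ hρ0.le
    have e2 := Finset.sum_range_succ (fun k => ‖(T^k) z‖ * (ρ⁻¹)^k) m
    have e3 := Finset.sum_range_succ' (fun k => ‖(T^k) z‖ * (ρ⁻¹)^k) m
    have h1 : ‖(T^m) z‖ * (ρ⁻¹)^m ≤ ‖z‖ := by
      rw [inv_pow, ← div_eq_mul_inv, div_le_iff₀ (by positivity)]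
      have := hA z
      have := norm_nonneg z
      nlinarith
    have h2 : ‖(T^0) z‖ * (ρ⁻¹)^0 = ‖z‖ := by simp
    simp only [hN]
    linarith
  · exact continuous_finsetSum _ fun k _ => ((hcont k).norm).mul_const _

/-- Theorem 2: interconnection of two ensembles with nonlinear contractive agents and stable
linear controllers and filters.  The maps `W ℓ (x, z) = (w ℓ x, A z + g ℓ x)` with `w ℓ`
contractive, `g ℓ` globally Lipschitz and `A` Schur, chosen with Dini continuous probabilities
bounded below by `δ > 0`, give a Markov kernel with a unique, attractive invariant Borel
probability measure. -/
theorem nonlinear_two_ensemble_unique_attractive_invariant_measure {nS nC L : ℕ}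
    (A : Matrix (Fin nC) (Fin nC) ℝ) (hA : IsSchur A)
    (w : Fin L → EuclideanSpace ℝ (Fin nS) → EuclideanSpace ℝ (Fin nS))
    (l : Fin L → NNReal) (hl : ∀ ℓ, l ℓ < 1) (hw : ∀ ℓ, LipschitzWith (l ℓ) (w ℓ))
    (g : Fin L → EuclideanSpace ℝ (Fin nS) → EuclideanSpace ℝ (Fin nC))
    (hg : ∀ ℓ, ∃ K : NNReal, LipschitzWith K (g ℓ))
    (W : Fin L → EuclideanSpace ℝ (Fin nS) × EuclideanSpace ℝ (Fin nC) →
      EuclideanSpace ℝ (Fin nS) × EuclideanSpace ℝ (Fin nC))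
    (hW : ∀ ℓ x z, W ℓ (x, z) = (w ℓ x, Matrix.toEuclideanLin A z + g ℓ x))
    (p : Fin L → EuclideanSpace ℝ (Fin nS) × EuclideanSpace ℝ (Fin nC) → ℝ)
    (hp01 : ∀ ℓ ξ, p ℓ ξ ∈ Set.Icc (0 : ℝ) 1)
    (hpDini : ∀ ℓ, DiniContinuous (p ℓ))
    (hpsum : ∀ ξ, ∑ ℓ, p ℓ ξ = 1)
    (δ : ℝ) (hδ : 0 < δ) (hplb : ∀ ℓ ξ, δ ≤ p ℓ ξ) :
    ∃ μstar : Measure (EuclideanSpace ℝ (Fin nS) × EuclideanSpace ℝ (Fin nC)),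
      (IsProbabilityMeasure μstar ∧ Invariant (IFSKernel p W) μstar) ∧
      (∀ μ : Measure (EuclideanSpace ℝ (Fin nS) × EuclideanSpace ℝ (Fin nC)),
        IsProbabilityMeasure μ → Invariant (IFSKernel p W) μ → μ = μstar) ∧
      Attractive (IFSKernel p W) μstar := by
  obtain ⟨N, ρ, C, hρ0, hρ1, hC, hN1, hN2, hNneg, hNadd, hNA, hNc⟩ := aux_norm A hA
  choose K hK using hg
  obtain ⟨lam, hlam0, hlam1, hlam⟩ : ∃ lam : ℝ, 0 ≤ lam ∧ lam < 1 ∧ ∀ i, (l i : ℝ) ≤ lam := by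
    refine ⟨((Finset.univ.sup l : NNReal) : ℝ), NNReal.coe_nonneg _, ?_, fun i => ?_⟩
    · exact_mod_cast (Finset.sup_lt_iff (by simp)).2 fun i _ => hl i
    · exact_mod_cast Finset.le_sup (f := l) (Finset.mem_univ i)
  set Km : ℝ := ∑ i, (K i : ℝ) with hKm
  have hKm0 : 0 ≤ Km := Finset.sum_nonneg fun i _ => NNReal.coe_nonneg _
  have hKle : ∀ i, (K i : ℝ) ≤ Km := fun i =>
    Finset.single_le_sum (f := fun i => (K i : ℝ)) (fun i _ => NNReal.coe_nonneg _)
      (Finset.mem_univ i)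
  set M : ℝ := 1 + 2 * (C * Km) / (1 - lam) with hM
  have h1l : 0 < 1 - lam := by linarith
  have hCK : 0 ≤ C * Km := mul_nonneg hC hKm0
  have hM1 : 1 ≤ M := by
    have : 0 ≤ 2 * (C * Km) / (1 - lam) := by positivity
    linarith
  have hMK : C * Km ≤ (1 - lam) / 2 * M := by
    have : (1 - lam) / 2 * M = (1 - lam) / 2 + C * Km := by rw [hM]; field_simp
    linarith
  set r : ℝ := max ρ ((1 + lam) / 2) with hr
  have hN0 : ∀ z, 0 ≤ N z := fun z => (norm_nonneg z).trans (hN1 z)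
  have hNz : N 0 = 0 := le_antisymm (by simpa using hN2 0) (hN0 0)
  have hsys : AuxIFS p W (fun ξ η => M * dist ξ.1 η.1 + N (ξ.2 - η.2)) r δ 0 := by
    refine ⟨?_, ?_, ?_, ?_, ?_, ?_, ?_, ?_, ?_, hpsum, hδ, hplb, hpDini⟩
    · intro x y
      have a1 : dist x.1 y.1 ≤ M * dist x.1 y.1 := le_mul_of_one_le_left dist_nonneg hM1
      have a2 := hN1 (x.2 - y.2)
      rw [← dist_eq_norm] at a2
      have a3 : 0 ≤ dist x.1 y.1 := dist_nonneg
      have a4 : 0 ≤ dist x.2 y.2 := dist_nonneg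
      rw [Prod.dist_eq]
      exact max_le (by linarith) (by linarith)
    · intro x y
      have : N (x.2 - y.2) = N (y.2 - x.2) := by rw [← hNneg, neg_sub]
      simp only [dist_comm x.1, this]
    · intro x y z
      have a1 := hNadd (x.2 - y.2) (y.2 - z.2)
      rw [sub_add_sub_cancel] at a1
      have a2 := mul_le_mul_of_nonneg_left (dist_triangle x.1 y.1 z.1) (zero_le_one.trans hM1)
      linarith
    · intro x; simp [hNz]
    · exact lt_max_of_lt_left hρ0
    · exact max_lt hρ1 (by linarith)
    · rintro i ⟨x, z⟩ ⟨y, u⟩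
      simp only [hW]
      have e : Matrix.toEuclideanLin A z + g i x - (Matrix.toEuclideanLin A u + g i y)
          = Matrix.toEuclideanLin A (z - u) + (g i x - g i y) := by rw [map_sub]; abel
      rw [e]
      have d0 : 0 ≤ dist x y := dist_nonneg
      have a1 := hNadd (Matrix.toEuclideanLin A (z - u)) (g i x - g i y)
      have a2 := hNA (z - u)
      have a3 := hN2 (g i x - g i y)
      rw [← dist_eq_norm] at a3
      have a4 := mul_le_mul_of_nonneg_left (((hK i).dist_le_mul x y).trans
        (mul_le_mul_of_nonneg_right (hKle i) d0)) hC
      have a5 := mul_le_mul_of_nonneg_left (((hw i).dist_le_mul x y).trans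
        (mul_le_mul_of_nonneg_right (hlam i) d0)) (zero_le_one.trans hM1)
      have a6 := mul_le_mul_of_nonneg_right hMK d0
      have a7 : (1 + lam) / 2 * (M * dist x y) ≤ r * (M * dist x y) :=
        mul_le_mul_of_nonneg_right (le_max_right _ _) (mul_nonneg (zero_le_one.trans hM1) d0)
      have a8 : ρ * N (z - u) ≤ r * N (z - u) :=
        mul_le_mul_of_nonneg_right (le_max_left _ _) (hN0 _)
      nlinarith
    · intro i
      have e : W i = fun ξ => (w i ξ.1, Matrix.toEuclideanLin A ξ.2 + g i ξ.1) :=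
        funext fun ξ => hW i ξ.1 ξ.2
      rw [e]
      have c1 : Continuous (Matrix.toEuclideanLin A) :=
        LinearMap.continuous_of_finiteDimensional _
      exact ((hw i).continuous.comp continuous_fst).prodMk
        ((c1.comp continuous_snd).add ((hK i).continuous.comp continuous_fst))
    · exact ((continuous_fst.dist continuous_const).const_mul M).add
        (hNc.comp (continuous_snd.sub continuous_const))
  exact hsys.final
end
end
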